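/- arXiv:0908.0558 — 2 statements merged into one kernel-verified Lean document; each statement's English description precedes it below -/
import Mathlib

section
/- For every n ≥ 1 and t < 0, the derivative of the subleading coefficient of P_n with respect to the parameter t satisfies (d/dt)p₁(n) = r_n − r*_n − n; moreover the derivatives of r_n and r*_n are related by t·(d/dt)r*_n = (t−1)·(d/dt)r_n. -/
open MeasureTheory Real

/-- The generalized Jacobi weight `w(x;t) = (x-t)^γ x^α (1-x)^β`. -/
noncomputable def genJacobiWeight (α β γ t x : ℝ) : ℝ :=
  (x - t) ^ γ * x ^ α * (1 - x) ^ β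

open Polynomial in
/-- A polynomial of degree less than `n` is a combination of the first `n` members of a sequence of
monic polynomials of increasing degree. -/
theorem exists_eq_sum_of_monic_sequence {S : ℕ → ℝ[X]}
    (hS : ∀ n, (S n).Monic ∧ (S n).natDegree = n) (n : ℕ) :
    ∀ Q : ℝ[X], Q.degree < n → ∃ c : ℕ → ℝ, Q = ∑ j ∈ Finset.range n, c j • S j := by
  induction n with
  | zero =>
    intro Q hQ
    refine ⟨0, ?_⟩
    have : Q = 0 := by
      rw [← Polynomial.degree_eq_bot]
      exact (Nat.WithBot.lt_zero_iff).1 (by simpa using hQ)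
    simp [this]
  | succ n ih =>
    intro Q hQ
    have hlt : (Q - Q.coeff n • S n).degree < n := by
      rw [Polynomial.degree_lt_iff_coeff_zero] at hQ ⊢
      intro m hm
      rcases hm.eq_or_lt with rfl | hm
      · have : (S n).coeff n = 1 := by
          have := (hS n).1.coeff_natDegree
          rwa [(hS n).2] at this
        simp [this]
      · have h1 : (S n).coeff m = 0 :=
          Polynomial.coeff_eq_zero_of_natDegree_lt (by rw [(hS n).2]; exact hm)
        simp [h1, hQ m hm]
    obtain ⟨c, hc⟩ := ih _ hlt
    refine ⟨fun j => if j = n then Q.coeff n else c j, ?_⟩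
    simp only [Finset.sum_range_succ, if_true]
    rw [← sub_eq_iff_eq_add, hc]
    refine Finset.sum_congr rfl fun j hj => ?_
    rw [if_neg (Finset.mem_range.1 hj).ne]

open Polynomial in
/-- A polynomial orthogonal to all lower members of a monic sequence is orthogonal to every
polynomial of lower degree. -/
theorem map_mul_eq_zero_of_degree_lt {S : ℕ → ℝ[X]}
    (hS : ∀ n, (S n).Monic ∧ (S n).natDegree = n) (L : ℝ[X] →ₗ[ℝ] ℝ) {n : ℕ} {R : ℝ[X]}
    (hL : ∀ m < n, L (R * S m) = 0) {Q : ℝ[X]} (hQ : Q.degree < n) : L (R * Q) = 0 := by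
  obtain ⟨c, rfl⟩ := exists_eq_sum_of_monic_sequence hS n Q hQ
  rw [Finset.mul_sum, map_sum]
  refine Finset.sum_eq_zero fun j hj => ?_
  rw [mul_smul_comm, map_smul, hL j (Finset.mem_range.1 hj), smul_zero]

/-- The determinant of a matrix depending differentiably on a parameter is differentiable. -/
theorem differentiableAt_matrix_det {n : ℕ} {M : ℝ → Matrix (Fin n) (Fin n) ℝ} {t : ℝ}
    (hM : ∀ i j, DifferentiableAt ℝ (fun s => M s i j) t) :
    DifferentiableAt ℝ (fun s => (M s).det) t := by
  simp only [Matrix.det_apply']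
  fun_prop

/-- The solution of a linear system depending differentiably on a parameter is differentiable
where the system is nonsingular. -/
theorem differentiableAt_of_mulVec_eq {n : ℕ} {M : ℝ → Matrix (Fin n) (Fin n) ℝ}
    {b c : ℝ → Fin n → ℝ} {t : ℝ} (hM : ∀ i j, DifferentiableAt ℝ (fun s => M s i j) t)
    (hb : ∀ i, DifferentiableAt ℝ (fun s => b s i) t) (hdet : (M t).det ≠ 0)
    (hc : ∀ᶠ s in nhds t, (M s).mulVec (c s) = b s) (i : Fin n) :
    DifferentiableAt ℝ (fun s => c s i) t := by
  have hd := differentiableAt_matrix_det hM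
  have hcr : DifferentiableAt ℝ (fun s => (M s).cramer (b s) i) t := by
    simp only [Matrix.cramer_apply]
    refine differentiableAt_matrix_det fun j k => ?_
    simp only [Matrix.updateCol_apply]
    split_ifs
    · exact hb j
    · exact hM j k
  refine (hcr.div hd hdet).congr_of_eventuallyEq ?_
  filter_upwards [hc, hd.continuousAt.eventually_ne hdet] with s hs hs0
  have h1 := congrFun (congrArg ((M s).adjugate.mulVec) hs) i
  rw [Matrix.mulVec_mulVec, Matrix.adjugate_mul, Matrix.smul_mulVec, Matrix.one_mulVec,
    ← Matrix.cramer_eq_adjugate_mulVec] at h1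
  rw [Pi.div_apply, ← h1, Pi.smul_apply, smul_eq_mul, mul_div_cancel_left₀ _ hs0]

open Polynomial in
/-- If `P s` is the sequence of monic orthogonal polynomials of a moment functional `L s`
depending differentiably on `s`, then the subleading coefficient of `P s n` is differentiable, with
derivative `-L' (P t n * P t (n - 1)) / h (n - 1)`. -/
theorem hasDerivAt_subleading_coeff {L : ℝ → ℝ[X] →ₗ[ℝ] ℝ} {L' : ℝ[X] → ℝ} {t : ℝ}
    {P : ℝ → ℕ → ℝ[X]} {h : ℝ → ℕ → ℝ} {n : ℕ}
    (hL : ∀ Q, HasDerivAt (fun s => L s Q) (L' Q) t)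
    (hmonic : ∀ᶠ s in nhds t, ∀ n, (P s n).Monic ∧ (P s n).natDegree = n)
    (hpos : ∀ n, 0 < h t n)
    (horth : ∀ᶠ s in nhds t, ∀ m n, L s (P s m * P s n) = if m = n then h s n else 0) :
    HasDerivAt (fun s => (P s (n + 1)).coeff n) (-L' (P t (n + 1) * P t n) / h t n) t := by
  have hm := hmonic.self_of_nhds
  have ho := horth.self_of_nhds
  have hex : ∀ s, ∃ c : ℕ → ℝ, (∀ n, (P s n).Monic ∧ (P s n).natDegree = n) →
      P s (n + 1) = P t (n + 1) + ∑ j ∈ Finset.range (n + 1), c j • P t j := by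
    intro s
    by_cases hs : ∀ n, (P s n).Monic ∧ (P s n).natDegree = n
    · have hlt : (P s (n + 1) - P t (n + 1)).degree < ((n + 1 : ℕ) : WithBot ℕ) := by
        have h1 : (P s (n + 1)).degree = ((n + 1 : ℕ) : WithBot ℕ) := by
          rw [Polynomial.degree_eq_natDegree (hs _).1.ne_zero, (hs _).2]
        have h2 : (P t (n + 1)).degree = ((n + 1 : ℕ) : WithBot ℕ) := by
          rw [Polynomial.degree_eq_natDegree (hm _).1.ne_zero, (hm _).2]
        have := Polynomial.degree_sub_lt_left (h1.trans h2.symm) (hs _).1.ne_zero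
          (by rw [(hs _).1.leadingCoeff, (hm _).1.leadingCoeff])
        rwa [h1] at this
      obtain ⟨c, hc⟩ := exists_eq_sum_of_monic_sequence hm (n + 1) _ hlt
      exact ⟨c, fun _ => by rw [← hc]; ring⟩
    · exact ⟨0, fun h => absurd h hs⟩
  choose c hc using hex
  let M : ℝ → Matrix (Fin (n + 1)) (Fin (n + 1)) ℝ := fun s => .of fun k j => L s (P t j * P t k)
  let b : ℝ → Fin (n + 1) → ℝ := fun s k => -L s (P t (n + 1) * P t k)
  have hlin : ∀ᶠ s in nhds t, (M s).mulVec (fun j => c s j) = b s := by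
    filter_upwards [hmonic, horth] with s hs hos
    funext k
    have h0 : L s (P s (n + 1) * P t k) = 0 := by
      refine map_mul_eq_zero_of_degree_lt hs (L s) (n := n + 1) (fun m hm => ?_) ?_
      · rw [hos, if_neg (by omega)]
      · rw [Polynomial.degree_eq_natDegree (hm _).1.ne_zero, (hm _).2]
        exact_mod_cast k.2
    rw [hc s hs, add_mul, map_add, Finset.sum_mul, map_sum, Finset.sum_range] at h0
    simp only [smul_mul_assoc, map_smul, smul_eq_mul] at h0
    simp only [Matrix.mulVec, dotProduct, M, b, Matrix.of_apply]
    rw [← sub_eq_zero, sub_neg_eq_add, add_comm, ← h0]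
    congr 1
    exact Finset.sum_congr rfl fun j _ => mul_comm _ _
  have hMt : M t = Matrix.diagonal fun j : Fin (n + 1) => h t j := by
    ext k j
    simp only [M, Matrix.of_apply, ho, Matrix.diagonal_apply]
    by_cases hjk : k = j
    · simp [hjk]
    · rw [if_neg hjk, if_neg fun h => hjk (Fin.ext h.symm)]
  have hdet : (M t).det ≠ 0 := by
    rw [hMt, Matrix.det_diagonal]
    exact Finset.prod_ne_zero_iff.2 fun j _ => (hpos j).ne'
  have hct : ∀ j : Fin (n + 1), c t j = 0 := by
    intro j
    have h1 := congrFun hlin.self_of_nhds j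
    rw [hMt, Matrix.mulVec_diagonal] at h1
    simp only [b, ho] at h1
    rw [if_neg (by omega), neg_zero] at h1
    exact (mul_eq_zero.1 h1).resolve_left (hpos j).ne'
  have hdiff : ∀ j : Fin (n + 1), DifferentiableAt ℝ (fun s => c s j) t :=
    differentiableAt_of_mulVec_eq (c := fun s j => c s j)
      (fun i j => (hL (P t j * P t i)).differentiableAt)
      (fun i => (hL (P t (n + 1) * P t i)).differentiableAt.neg) hdet hlin
  have hsum : HasDerivAt (fun s => ∑ j : Fin (n + 1), L s (P t j * P t n) * c s j)
      (h t n * deriv (fun s => c s n) t) t := by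
    have h1 := HasDerivAt.fun_sum (u := Finset.univ) fun (j : Fin (n + 1)) _ =>
      (hL (P t j * P t n)).mul (hdiff j).hasDerivAt
    refine h1.congr_deriv ?_
    rw [Fin.sum_univ_castSucc]
    have hlast : c t n = 0 := hct (Fin.last n)
    simp only [Fin.val_last, ho, hlast, if_true]
    rw [Finset.sum_eq_zero, mul_zero, zero_add, zero_add]
    intro j _
    rw [hct, Fin.val_castSucc, if_neg (by omega), mul_zero, zero_mul, zero_add]
  have heq : (fun s => ∑ j : Fin (n + 1), L s (P t j * P t n) * c s j) =ᶠ[nhds t]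
      fun s => -L s (P t (n + 1) * P t n) := by
    filter_upwards [hlin] with s hs
    exact congrFun hs (Fin.last n)
  have hval : h t n * deriv (fun s => c s n) t = -L' (P t (n + 1) * P t n) :=
    hsum.unique ((hL _).neg.congr_of_eventuallyEq heq)
  have hcn : HasDerivAt (fun s => c s n) (-L' (P t (n + 1) * P t n) / h t n) t := by
    rw [← hval, mul_div_cancel_left₀ _ (hpos n).ne']
    exact (hdiff (Fin.last n)).hasDerivAt
  refine (hcn.const_add ((P t (n + 1)).coeff n)).congr_of_eventuallyEq ?_
  filter_upwards [hmonic] with s hs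
  have hcoeff : (P t n).coeff n = 1 := by
    have := (hm n).1.coeff_natDegree
    rwa [(hm n).2] at this
  rw [hc s hs, Polynomial.coeff_add, Finset.sum_range_succ, Polynomial.coeff_add,
    Polynomial.finsetSum_coeff, Finset.sum_eq_zero, Polynomial.coeff_smul, hcoeff]
  · simp
  · intro j hj
    rw [Polynomial.coeff_smul, Polynomial.coeff_eq_zero_of_natDegree_lt, smul_zero]
    rw [(hm j).2]
    exact Finset.mem_range.1 hj

theorem continuousOn_genJacobiWeight {α β : ℝ} (hα : 0 < α) (hβ : 0 < β) (γ : ℝ) {t : ℝ}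
    (ht : t < 0) : ContinuousOn (genJacobiWeight α β γ t) (Set.Icc 0 1) := by
  unfold genJacobiWeight
  refine ContinuousOn.mul (ContinuousOn.mul ?_ ?_) ?_
  · exact ContinuousOn.rpow_const (by fun_prop) fun x hx => Or.inl (by linarith [hx.1])
  · exact ContinuousOn.rpow_const (by fun_prop) fun x hx => Or.inr hα.le
  · exact ContinuousOn.rpow_const (by fun_prop) fun x hx => Or.inr hβ.le

theorem intervalIntegrable_mul_genJacobiWeight {α β : ℝ} (hα : 0 < α) (hβ : 0 < β) (γ : ℝ) {t : ℝ}
    (ht : t < 0) {f : ℝ → ℝ} (hf : ContinuousOn f (Set.Icc 0 1)) :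
    IntervalIntegrable (fun x => f x * genJacobiWeight α β γ t x) volume 0 1 :=
  ContinuousOn.intervalIntegrable (by
    rw [Set.uIcc_of_le zero_le_one]
    exact hf.mul (continuousOn_genJacobiWeight hα hβ γ ht))

theorem intervalIntegrable_mul_genJacobiWeight_div_sub {α β : ℝ} (hα : 0 < α) (hβ : 0 < β) (γ : ℝ)
    {t : ℝ} (ht : t < 0) {f : ℝ → ℝ} (hf : ContinuousOn f (Set.Icc 0 1)) :
    IntervalIntegrable (fun x => f x * genJacobiWeight α β γ t x / (x - t)) volume 0 1 :=
  ContinuousOn.intervalIntegrable (by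
    rw [Set.uIcc_of_le zero_le_one]
    exact (hf.mul (continuousOn_genJacobiWeight hα hβ γ ht)).div (by fun_prop)
      fun x hx => by linarith [hx.1])

theorem intervalIntegrable_mul_genJacobiWeight_div {α β : ℝ} (hα : 0 < α) (hβ : 0 < β) (γ : ℝ)
    {t : ℝ} (ht : t < 0) {f : ℝ → ℝ} (hf : ContinuousOn f (Set.Icc 0 1)) :
    IntervalIntegrable (fun x => f x * genJacobiWeight α β γ t x / x) volume 0 1 := by
  have h1 : IntervalIntegrable (fun x : ℝ => x ^ (α - 1)) volume 0 1 :=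
    intervalIntegral.intervalIntegrable_rpow' (by linarith)
  have h2 : ContinuousOn (fun x => f x * (x - t) ^ γ * (1 - x) ^ β) (Set.uIcc 0 1) := by
    rw [Set.uIcc_of_le zero_le_one]
    refine (hf.mul ?_).mul ?_
    · exact ContinuousOn.rpow_const (by fun_prop) fun x hx => Or.inl (by linarith [hx.1])
    · exact ContinuousOn.rpow_const (by fun_prop) fun x hx => Or.inr hβ.le
  refine (h1.mul_continuousOn h2).congr_uIoo fun x hx => ?_
  rw [Set.uIoo_of_le zero_le_one] at hx
  simp only [genJacobiWeight, Real.rpow_sub_one hx.1.ne']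
  ring

theorem intervalIntegrable_mul_genJacobiWeight_div_one_sub {α β : ℝ} (hα : 0 < α) (hβ : 0 < β)
    (γ : ℝ) {t : ℝ} (ht : t < 0) {f : ℝ → ℝ} (hf : ContinuousOn f (Set.Icc 0 1)) :
    IntervalIntegrable (fun x => f x * genJacobiWeight α β γ t x / (1 - x)) volume 0 1 := by
  have h1 : IntervalIntegrable (fun x : ℝ => (1 - x) ^ (β - 1)) volume 0 1 := by
    have := (intervalIntegral.intervalIntegrable_rpow' (r := β - 1) (a := 0) (b := 1)
      (by linarith)).comp_sub_left 1
    simpa using this.symm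
  have h2 : ContinuousOn (fun x => f x * (x - t) ^ γ * x ^ α) (Set.uIcc 0 1) := by
    rw [Set.uIcc_of_le zero_le_one]
    refine (hf.mul ?_).mul ?_
    · exact ContinuousOn.rpow_const (by fun_prop) fun x hx => Or.inl (by linarith [hx.1])
    · exact ContinuousOn.rpow_const (by fun_prop) fun x hx => Or.inr hα.le
  refine (h1.mul_continuousOn h2).congr_uIoo fun x hx => ?_
  rw [Set.uIoo_of_le zero_le_one] at hx
  simp only [genJacobiWeight, Real.rpow_sub_one (sub_pos.2 hx.2).ne']
  ring

theorem hasDerivAt_genJacobiWeight (α β γ : ℝ) {t x : ℝ} (ht : t < 0) (hx : x ∈ Set.Ioo (0 : ℝ) 1) :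
    HasDerivAt (genJacobiWeight α β γ t)
      (genJacobiWeight α β γ t x * (γ / (x - t) + α / x - β / (1 - x))) x := by
  have h0 : x - t ≠ 0 := by linarith [hx.1]
  have h1 : x ≠ 0 := hx.1.ne'
  have h2 : 1 - x ≠ 0 := (sub_pos.2 hx.2).ne'
  have d0 := ((hasDerivAt_id x).sub_const t).rpow_const (p := γ) (Or.inl h0)
  have d1 := (hasDerivAt_id x).rpow_const (p := α) (Or.inl h1)
  have d2 := ((hasDerivAt_id x).const_sub 1).rpow_const (p := β) (Or.inl h2)
  refine ((d0.mul d1).mul d2).congr_deriv ?_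
  simp only [genJacobiWeight, id, Pi.mul_apply, Real.rpow_sub_one h0, Real.rpow_sub_one h1,
    Real.rpow_sub_one h2]
  field_simp
  ring

open Polynomial in
/-- Integration by parts against the generalized Jacobi weight: the boundary terms vanish. -/
theorem integral_derivative_mul_genJacobiWeight {α β : ℝ} (hα : 0 < α) (hβ : 0 < β) (γ : ℝ) {t : ℝ}
    (ht : t < 0) (Q : ℝ[X]) :
    (∫ x in (0:ℝ)..1, (derivative Q).eval x * genJacobiWeight α β γ t x)
      + γ * (∫ x in (0:ℝ)..1, Q.eval x * genJacobiWeight α β γ t x / (x - t))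
      + α * (∫ x in (0:ℝ)..1, Q.eval x * genJacobiWeight α β γ t x / x)
      - β * (∫ x in (0:ℝ)..1, Q.eval x * genJacobiWeight α β γ t x / (1 - x)) = 0 := by
  have hQ : ContinuousOn (fun x => Q.eval x) (Set.Icc 0 1) := Q.continuous.continuousOn
  have i0 := intervalIntegrable_mul_genJacobiWeight hα hβ γ ht
    (derivative Q).continuous.continuousOn
  have i1 := (intervalIntegrable_mul_genJacobiWeight_div_sub hα hβ γ ht hQ).const_mul γ
  have i2 := (intervalIntegrable_mul_genJacobiWeight_div hα hβ γ ht hQ).const_mul α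
  have i3 := (intervalIntegrable_mul_genJacobiWeight_div_one_sub hα hβ γ ht hQ).const_mul β
  simp only [← intervalIntegral.integral_const_mul]
  rw [← intervalIntegral.integral_add i0 i1, ← intervalIntegral.integral_add (i0.add i1) i2,
    ← intervalIntegral.integral_sub ((i0.add i1).add i2) i3]
  rw [intervalIntegral.integral_eq_sub_of_hasDerivAt_of_le
    (f := fun x => Q.eval x * genJacobiWeight α β γ t x) zero_le_one
    (hQ.mul (continuousOn_genJacobiWeight hα hβ γ ht)) (fun x hx => ?_)
    (((i0.add i1).add i2).sub i3)]
  · simp [genJacobiWeight, Real.zero_rpow hα.ne', Real.zero_rpow hβ.ne']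
  · refine ((Q.hasDerivAt x).mul (hasDerivAt_genJacobiWeight α β γ ht hx)).congr_deriv ?_
    ring

/-- The moment functional of the generalized Jacobi weight, differentiated in the parameter. -/
theorem hasDerivAt_integral_mul_genJacobiWeight {α β : ℝ} (hα : 0 < α) (hβ : 0 < β) (γ : ℝ) {t : ℝ}
    (ht : t < 0) {f : ℝ → ℝ} (hf : ContinuousOn f (Set.Icc 0 1)) :
    HasDerivAt (fun s => ∫ x in (0:ℝ)..1, f x * genJacobiWeight α β γ s x)
      (-γ * ∫ x in (0:ℝ)..1, f x * genJacobiWeight α β γ t x / (x - t)) t := by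
  let g : ℝ → ℝ := fun x => f x * x ^ α * (1 - x) ^ β
  have hg : ContinuousOn g (Set.Icc 0 1) := by
    refine (hf.mul ?_).mul ?_
    · exact ContinuousOn.rpow_const (by fun_prop) fun x hx => Or.inr hα.le
    · exact ContinuousOn.rpow_const (by fun_prop) fun x hx => Or.inr hβ.le
  have hnhds : Set.Icc (3 * t / 2) (t / 2) ∈ nhds t := Icc_mem_nhds (by linarith) (by linarith)
  obtain ⟨C, hC⟩ := (isCompact_Icc (a := -t / 2) (b := 1 - 3 * t / 2)).exists_bound_of_continuousOn
    (f := fun u : ℝ => u ^ (γ - 1)) (ContinuousOn.rpow_const (by fun_prop)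
      fun u hu => Or.inl (by linarith [hu.1]))
  have hIoc : Set.uIoc (0:ℝ) 1 ⊆ Set.Icc 0 1 := by
    rw [Set.uIoc_of_le zero_le_one]
    exact Set.Ioc_subset_Icc_self
  have hgi : IntervalIntegrable g volume 0 1 :=
    ContinuousOn.intervalIntegrable (by rwa [Set.uIcc_of_le zero_le_one])
  have key := (intervalIntegral.hasDerivAt_integral_of_dominated_loc_of_deriv_le
    (F := fun s x => f x * genJacobiWeight α β γ s x)
    (F' := fun s x => g x * (-γ * (x - s) ^ (γ - 1))) (μ := volume) (a := 0) (b := 1) (x₀ := t)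
    (bound := fun x => ‖g x‖ * (|γ| * C)) hnhds ?_
    (intervalIntegrable_mul_genJacobiWeight hα hβ γ ht hf) ?_ ?_ (hgi.norm.mul_const _) ?_).2
  · refine key.congr_deriv ?_
    rw [← intervalIntegral.integral_const_mul]
    refine intervalIntegral.integral_congr fun x hx => ?_
    rw [Set.uIcc_of_le zero_le_one] at hx
    have h0 : x - t ≠ 0 := by linarith [hx.1]
    simp only [g, genJacobiWeight, Real.rpow_sub_one h0]
    ring
  · filter_upwards [gt_mem_nhds ht] with s hs
    exact (intervalIntegrable_mul_genJacobiWeight hα hβ γ hs hf).def'.aestronglyMeasurable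
  · refine (ContinuousOn.aestronglyMeasurable ?_ measurableSet_uIoc)
    refine (hg.mul (ContinuousOn.mul continuousOn_const ?_)).mono hIoc
    exact ContinuousOn.rpow_const (by fun_prop) fun x hx => Or.inl (by linarith [hx.1])
  · refine Filter.Eventually.of_forall fun x hx s hs => ?_
    have hx' := hIoc hx
    rw [norm_mul (g x), norm_mul (-γ), norm_neg, Real.norm_eq_abs γ]
    gcongr
    exact hC _ ⟨by linarith [hx'.1, hs.2], by linarith [hx'.2, hs.1]⟩
  · refine Filter.Eventually.of_forall fun x hx s hs => ?_
    have hx' := hIoc hx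
    have h0 : x - s ≠ 0 := by linarith [hx'.1, hs.2]
    have d := (((hasDerivAt_id s).const_sub x).rpow_const (p := γ) (Or.inl h0)).const_mul (g x)
    refine (d.congr_deriv ?_).congr_of_eventuallyEq (Filter.Eventually.of_forall fun u => ?_)
    · simp only [id]
      ring
    · simp only [g, genJacobiWeight, id]
      ring

open Polynomial in
/-- The moment functional of the generalized Jacobi weight on polynomials. -/
noncomputable def genJacobiFunctional {α β : ℝ} (hα : 0 < α) (hβ : 0 < β) (γ : ℝ) {t : ℝ}
    (ht : t < 0) : ℝ[X] →ₗ[ℝ] ℝ where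
  toFun Q := ∫ x in (0:ℝ)..1, Q.eval x * genJacobiWeight α β γ t x
  map_add' Q R := by
    simp only [eval_add, add_mul]
    exact intervalIntegral.integral_add
      (intervalIntegrable_mul_genJacobiWeight hα hβ γ ht Q.continuous.continuousOn)
      (intervalIntegrable_mul_genJacobiWeight hα hβ γ ht R.continuous.continuousOn)
  map_smul' c Q := by
    simp only [eval_smul, smul_eq_mul, mul_assoc, RingHom.id_apply,
      intervalIntegral.integral_const_mul]

open Polynomial in
theorem genJacobiFunctional_apply {α β : ℝ} (hα : 0 < α) (hβ : 0 < β) (γ : ℝ) {t : ℝ}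
    (ht : t < 0) (Q : ℝ[X]) : genJacobiFunctional hα hβ γ ht Q =
      ∫ x in (0:ℝ)..1, Q.eval x * genJacobiWeight α β γ t x := rfl

open Polynomial in
/-- Pairing the orthogonal polynomial of degree `m` with a polynomial of degree at most `m` extracts
the coefficient of index `m`. -/
theorem map_mul_eq_coeff_mul {S : ℕ → ℝ[X]} (hS : ∀ n, (S n).Monic ∧ (S n).natDegree = n)
    (L : ℝ[X] →ₗ[ℝ] ℝ) {m : ℕ} (hL : ∀ k < m, L (S m * S k) = 0) {R : ℝ[X]}
    (hR : R.degree < ((m + 1 : ℕ) : WithBot ℕ)) : L (S m * R) = R.coeff m * L (S m * S m) := by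
  have hc : (S m).coeff m = 1 := by
    have := (hS m).1.coeff_natDegree
    rwa [(hS m).2] at this
  have hlt : (R - R.coeff m • S m).degree < m := by
    rw [Polynomial.degree_lt_iff_coeff_zero] at hR ⊢
    intro k hk
    rcases hk.eq_or_lt with rfl | hk
    · simp [hc]
    · have h1 : (S m).coeff k = 0 :=
        Polynomial.coeff_eq_zero_of_natDegree_lt (by rw [(hS m).2]; exact hk)
      simp [h1, hR k hk]
  have h0 := map_mul_eq_zero_of_degree_lt hS L hL hlt
  rw [mul_sub, map_sub, mul_smul_comm, map_smul, smul_eq_mul] at h0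
  linarith

open Polynomial in
/-- The two integration by parts identities for consecutive orthogonal polynomials. -/
theorem genJacobi_consecutive_identities {α β : ℝ} (hα : 0 < α) (hβ : 0 < β) (γ : ℝ) {t : ℝ}
    (ht : t < 0) {S : ℕ → ℝ[X]} {h : ℕ → ℝ} (hS : ∀ n, (S n).Monic ∧ (S n).natDegree = n)
    (horth : ∀ m n, genJacobiFunctional hα hβ γ ht (S m * S n) = if m = n then h n else 0)
    (m : ℕ) :
    (m + 1) * h m
      + γ * (∫ x in (0:ℝ)..1, (S m * S (m + 1)).eval x * genJacobiWeight α β γ t x / (x - t))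
      + α * (∫ x in (0:ℝ)..1, (S m * S (m + 1)).eval x * genJacobiWeight α β γ t x / x)
      - β * (∫ x in (0:ℝ)..1, (S m * S (m + 1)).eval x * genJacobiWeight α β γ t x / (1 - x)) = 0 ∧
    -(S (m + 1)).coeff m * h m
      + γ * (t * ∫ x in (0:ℝ)..1,
          (S m * S (m + 1)).eval x * genJacobiWeight α β γ t x / (x - t))
      - β * (∫ x in (0:ℝ)..1,
          (S m * S (m + 1)).eval x * genJacobiWeight α β γ t x / (1 - x)) = 0 := by
  set L := genJacobiFunctional hα hβ γ ht with hLdef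
  set Q := S m * S (m + 1) with hQdef
  have hc : ∀ k, (S k).coeff k = 1 := fun k => by
    have := (hS k).1.coeff_natDegree
    rwa [(hS k).2] at this
  have hz : ∀ k j, k < j → (S k).coeff j = 0 := fun k j hkj =>
    coeff_eq_zero_of_natDegree_lt (by rw [(hS k).2]; exact hkj)
  have hlow : ∀ n, ∀ k < n, L (S n * S k) = 0 := fun n k hk => by
    rw [horth, if_neg hk.ne']
  have hmm : L (S m * S m) = h m := by rw [horth, if_pos rfl]
  have hQ0 : L Q = 0 := by rw [hQdef, horth, if_neg (by omega)]
  have hQc : ContinuousOn (fun x => Q.eval x) (Set.Icc 0 1) := Q.continuous.continuousOn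
  have hdeg : (derivative (S m)).degree < ((m + 1 : ℕ) : WithBot ℕ) := by
    rw [degree_lt_iff_coeff_zero]
    intro k hk
    rw [coeff_derivative, hz m _ (by omega), zero_mul]
  have hXdeg : (X * derivative (S m)).degree < ((m + 1 : ℕ) : WithBot ℕ) := by
    rw [degree_lt_iff_coeff_zero]
    intro k hk
    obtain ⟨k, rfl⟩ : ∃ j, k = j + 1 := ⟨k - 1, by omega⟩
    rw [coeff_X_mul, coeff_derivative, hz m _ (by omega), zero_mul]
  have hdeg' : (derivative (S (m + 1))).degree < ((m + 1 : ℕ) : WithBot ℕ) := by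
    rw [degree_lt_iff_coeff_zero]
    intro k hk
    rw [coeff_derivative, hz (m + 1) _ (by omega), zero_mul]
  have hXcoeff : ∀ k, (X * derivative (S (m + 1))).coeff k = k * (S (m + 1)).coeff k := by
    rintro (_ | k)
    · simp
    · rw [coeff_X_mul, coeff_derivative]
      push_cast
      ring
  have hXdeg' : (X * derivative (S (m + 1)) - ((m : ℝ) + 1) • S (m + 1)).degree <
      ((m + 1 : ℕ) : WithBot ℕ) := by
    rw [degree_lt_iff_coeff_zero]
    intro k hk
    rw [coeff_sub, hXcoeff, coeff_smul, smul_eq_mul]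
    rcases hk.eq_or_lt with rfl | hk
    · push_cast
      ring
    · rw [hz _ _ hk]
      ring
  constructor
  · have hD : L (derivative Q) = (m + 1) * h m := by
      rw [hQdef, derivative_mul, map_add, mul_comm (derivative (S m)),
        map_mul_eq_zero_of_degree_lt hS L (hlow (m + 1)) hdeg,
        map_mul_eq_coeff_mul hS L (hlow m) hdeg', coeff_derivative, hc, hmm]
      ring
    have := integral_derivative_mul_genJacobiWeight hα hβ γ ht Q
    rw [← genJacobiFunctional_apply hα hβ γ ht, ← hLdef, hD] at this
    exact this
  · have hD : L (derivative (X * Q)) = -(S (m + 1)).coeff m * h m := by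
      have hsplit : derivative (X * Q) = Q + S (m + 1) * (X * derivative (S m))
          + S m * (X * derivative (S (m + 1)) - ((m : ℝ) + 1) • S (m + 1))
          + ((m : ℝ) + 1) • Q := by
        rw [hQdef, derivative_mul, derivative_mul, derivative_X, mul_sub, mul_smul_comm]
        ring
      rw [hsplit, map_add, map_add, map_add, map_smul, hQ0,
        map_mul_eq_zero_of_degree_lt hS L (hlow (m + 1)) hXdeg,
        map_mul_eq_coeff_mul hS L (hlow m) hXdeg', hmm, coeff_sub, hXcoeff, coeff_smul,
        smul_eq_mul, smul_zero]
      ring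
    have hw0 : genJacobiWeight α β γ t 0 = 0 := by
      simp [genJacobiWeight, Real.zero_rpow hα.ne']
    have hw1 : genJacobiWeight α β γ t 1 = 0 := by
      simp [genJacobiWeight, Real.zero_rpow hβ.ne']
    have i0 := intervalIntegrable_mul_genJacobiWeight hα hβ γ ht hQc
    have hQint : (∫ x in (0:ℝ)..1, Q.eval x * genJacobiWeight α β γ t x) = 0 := hQ0
    have hJ : (∫ x in (0:ℝ)..1, (X * Q).eval x * genJacobiWeight α β γ t x / (x - t))
        = t * ∫ x in (0:ℝ)..1, Q.eval x * genJacobiWeight α β γ t x / (x - t) := by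
      have e := intervalIntegral.integral_add i0
        ((intervalIntegrable_mul_genJacobiWeight_div_sub hα hβ γ ht hQc).const_mul t)
      rw [hQint, zero_add, intervalIntegral.integral_const_mul] at e
      rw [← e]
      refine intervalIntegral.integral_congr fun x hx => ?_
      rw [Set.uIcc_of_le zero_le_one] at hx
      have h0 : x - t ≠ 0 := by linarith [hx.1]
      simp only [eval_mul, eval_X]
      field_simp
      ring
    have hA : (∫ x in (0:ℝ)..1, (X * Q).eval x * genJacobiWeight α β γ t x / x) = 0 := by
      refine Eq.trans ?_ hQint
      refine intervalIntegral.integral_congr fun x hx => ?_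
      simp only [eval_mul, eval_X]
      rcases eq_or_ne x 0 with rfl | h0
      · simp [hw0]
      · field_simp
    have hB : (∫ x in (0:ℝ)..1, (X * Q).eval x * genJacobiWeight α β γ t x / (1 - x))
        = ∫ x in (0:ℝ)..1, Q.eval x * genJacobiWeight α β γ t x / (1 - x) := by
      have e := intervalIntegral.integral_sub
        (intervalIntegrable_mul_genJacobiWeight_div_one_sub hα hβ γ ht hQc) i0
      rw [hQint, sub_zero] at e
      rw [← e]
      refine intervalIntegral.integral_congr fun x hx => ?_
      simp only [eval_mul, eval_X]
      rcases eq_or_ne x 1 with rfl | h1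
      · simp [hw1]
      · have : 1 - x ≠ 0 := sub_ne_zero.2 h1.symm
        field_simp
        ring
    have := integral_derivative_mul_genJacobiWeight hα hβ γ ht (X * Q)
    rw [← genJacobiFunctional_apply hα hβ γ ht, ← hLdef, hD, hJ, hA, hB, mul_zero, add_zero] at this
    exact this

theorem statement15
    (α β γ : ℝ) (hα : 0 < α) (hβ : 0 < β)
    (P : ℝ → ℕ → Polynomial ℝ) (h : ℝ → ℕ → ℝ)
    (hmonic : ∀ t < (0:ℝ), ∀ n, (P t n).Monic ∧ (P t n).natDegree = n)
    (hpos : ∀ t < (0:ℝ), ∀ n, 0 < h t n)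
    (horth : ∀ t < (0:ℝ), ∀ m n, (∫ x in (0:ℝ)..1,
        (P t m).eval x * (P t n).eval x * genJacobiWeight α β γ t x)
      = if m = n then h t n else 0)
    (r rs : ℝ → ℕ → ℝ)
    (hr : ∀ t < (0:ℝ), ∀ n, 1 ≤ n → r t n = β / h t (n - 1) *
      ∫ y in (0:ℝ)..1, (P t (n - 1)).eval y * (P t n).eval y
        * genJacobiWeight α β γ t y / (1 - y))
    (hrs : ∀ t < (0:ℝ), ∀ n, 1 ≤ n → rs t n = α / h t (n - 1) *
      ∫ y in (0:ℝ)..1, (P t (n - 1)).eval y * (P t n).eval y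
        * genJacobiWeight α β γ t y / y)
    :
    ∀ n : ℕ, 1 ≤ n → ∀ t < (0:ℝ),
      deriv (fun s => (P s n).coeff (n - 1)) t = r t n - rs t n - n ∧
      t * deriv (fun s => rs s n) t = (t - 1) * deriv (fun s => r s n) t := by
  intro n hn t ht
  obtain ⟨m, rfl⟩ : ∃ m, n = m + 1 := ⟨n - 1, by omega⟩
  simp only [Nat.add_sub_cancel] at *
  have horth' : ∀ s (hs : s < 0) (i j : ℕ), genJacobiFunctional hα hβ γ hs (P s i * P s j)
      = if i = j then h s j else 0 := fun s hs i j => by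
    rw [genJacobiFunctional_apply, ← horth s hs i j]
    simp only [Polynomial.eval_mul]
  have hids : ∀ s < 0, HasDerivAt (fun s => (P s (m + 1)).coeff m)
        (r s (m + 1) - rs s (m + 1) - (m + 1)) s ∧
      s * rs s (m + 1) = (s - 1) * r s (m + 1) - (P s (m + 1)).coeff m - (m + 1) * s := by
    intro s hs
    have hH := (hpos s hs m).ne'
    obtain ⟨h1, h2⟩ := genJacobi_consecutive_identities hα hβ γ hs (hmonic s hs) (horth' s hs) m
    have hr' := hr s hs (m + 1) hn
    have hrs' := hrs s hs (m + 1) hn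
    simp only [Nat.add_sub_cancel, ← Polynomial.eval_mul] at hr' hrs'
    have hev : ∀ᶠ u in nhds s, u < 0 := gt_mem_nhds hs
    have hder := hasDerivAt_subleading_coeff (t := s) (P := P) (h := h) (n := m)
      (L := fun u => if hu : u < 0 then genJacobiFunctional hα hβ γ hu else 0)
      (L' := fun Q => -γ * ∫ x in (0:ℝ)..1, Q.eval x * genJacobiWeight α β γ s x / (x - s))
      (fun Q => (hasDerivAt_integral_mul_genJacobiWeight hα hβ γ hs
        Q.continuous.continuousOn).congr_of_eventuallyEq (by
          filter_upwards [hev] with u hu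
          rw [dif_pos hu, genJacobiFunctional_apply]))
      (hev.mono hmonic) (hpos s hs) (by
        filter_upwards [hev] with u hu
        rw [dif_pos hu]
        exact horth' u hu)
    rw [mul_comm (P s (m + 1))] at hder
    refine ⟨hder.congr_deriv ?_, ?_⟩
    · rw [hr', hrs']
      field_simp
      linarith
    · rw [hr', hrs']
      field_simp
      linear_combination s * h1 - h2
  obtain ⟨hd, -⟩ := hids t ht
  refine ⟨by rw [hd.deriv]; push_cast; ring, ?_⟩
  have hev : ∀ᶠ s in nhds t, s < 0 := gt_mem_nhds ht
  have heq : (fun s => s * rs s (m + 1)) =ᶠ[nhds t]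
      fun s => (s - 1) * r s (m + 1) - (P s (m + 1)).coeff m - (m + 1) * s := by
    filter_upwards [hev] with s hs
    exact (hids s hs).2
  by_cases hrd : DifferentiableAt ℝ (fun s => r s (m + 1)) t
  · have hrsd : DifferentiableAt ℝ (fun s => rs s (m + 1)) t := by
      have hq : DifferentiableAt ℝ (fun s => ((s - 1) * r s (m + 1) - (P s (m + 1)).coeff m
          - (m + 1) * s) / s) t := by
        have := hd.differentiableAt
        exact DifferentiableAt.div (by fun_prop) (by fun_prop) ht.ne
      refine hq.congr_of_eventuallyEq ?_
      filter_upwards [hev, heq] with s hs hs'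
      rw [← hs', mul_div_cancel_left₀ _ hs.ne]
    have e1 := (hasDerivAt_id t).mul hrsd.hasDerivAt
    have e2 := ((((hasDerivAt_id t).sub_const 1).mul hrd.hasDerivAt).sub hd).sub
      ((hasDerivAt_id t).const_mul ((m : ℝ) + 1))
    have e3 := e1.unique (e2.congr_of_eventuallyEq heq)
    simp only [id] at e3
    linarith
  · have hrsd : ¬ DifferentiableAt ℝ (fun s => rs s (m + 1)) t := by
      intro hrsd
      refine hrd ?_
      have hq : DifferentiableAt ℝ (fun s => (s * rs s (m + 1) + (P s (m + 1)).coeff m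
          + (m + 1) * s) / (s - 1)) t := by
        have := hd.differentiableAt
        exact DifferentiableAt.div (by fun_prop) (by fun_prop) (by linarith)
      refine hq.congr_of_eventuallyEq ?_
      filter_upwards [hev, heq] with s hs hs'
      rw [eq_div_iff (by linarith), hs']
      ring
    rw [deriv_zero_of_not_differentiableAt hrd, deriv_zero_of_not_differentiableAt hrsd]
    simp
end

section
/- For every n ≥ 1 and t < 0, the auxiliary quantity R_n admits the two representations R_n(t) = (2n+1+α+β+γ)[l(r_n, r*_n, t) − t(1−t)r_n′(t)] / (2k(r_n, r*_n, t)) and 1/R_n(t) = [l(r_n, r*_n, t) + t(1−t)r_n′(t)] / (2(2n+1+α+β+γ)(β + r_n)r_n), where l(r_n, r*_n, t) := 2(1−t)r_n² + [(2n−β+γ)t + 2β + 2t r*_n]r_n − (2n+α+γ)t r*_n − n(n+γ)t and k(r_n, r*_n, t) := [t r*_n − (t−1)r_n]² − (t−1)(2nt + γt + β)r_n + t[(t−1)(2n+γ) − α]r*_n + n(n+γ)(t²−t); consequently t²(t−1)²[r_n′(t)]² = l(r_n, r*_n, t)² − 4k(r_n, r*_n, t)(β + r_n)r_n. -/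
open MeasureTheory Real

/-- The quantity `l(r_n, r*_n, t)` from the paper. -/
noncomputable def lAux (α β γ : ℝ) (n : ℕ) (rn rsn t : ℝ) : ℝ :=
  2 * (1 - t) * rn ^ 2 + ((2 * n - β + γ) * t + 2 * β + 2 * t * rsn) * rn
    - (2 * n + α + γ) * t * rsn - n * (n + γ) * t

/-- The quantity `k(r_n, r*_n, t)` from the paper. -/
noncomputable def kAux (α β γ : ℝ) (n : ℕ) (rn rsn t : ℝ) : ℝ :=
  (t * rsn - (t - 1) * rn) ^ 2 - (t - 1) * (2 * n * t + γ * t + β) * rn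
    + t * ((t - 1) * (2 * n + γ) - α) * rsn + n * (n + γ) * (t ^ 2 - t)

section JacobiFunctional

open Polynomial Set Filter Topology

/-- The density `x ^ (α - 1) * (1 - x) ^ (β - 1)` of the Beta integral. -/
noncomputable def betaDensity (α β x : ℝ) : ℝ := x ^ (α - 1) * (1 - x) ^ (β - 1)

theorem intervalIntegrable_betaDensity {α β : ℝ} (hα : 0 < α) (hβ : 0 < β) :
    IntervalIntegrable (betaDensity α β) volume 0 1 := by
  have H := (Complex.betaIntegral_convergent (u := α) (v := β) (by simpa) (by simpa)).norm
  refine H.congr_uIoo fun x hx => ?_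
  rw [uIoo_of_le zero_le_one] at hx
  have h1 : (0 : ℝ) < 1 - x := by linarith [hx.2]
  have e1 : ((x : ℂ)) ^ ((α : ℂ) - 1) = ((x ^ (α - 1) : ℝ) : ℂ) := by
    rw [Complex.ofReal_cpow hx.1.le]; simp
  have e2 : (1 - (x : ℂ)) ^ ((β : ℂ) - 1) = (((1 - x) ^ (β - 1) : ℝ) : ℂ) := by
    rw [Complex.ofReal_cpow h1.le]; simp
  simp only [e1, e2, betaDensity, norm_mul, Complex.norm_real, Real.norm_eq_abs]
  rw [abs_of_pos (rpow_pos_of_pos hx.1 _), abs_of_pos (rpow_pos_of_pos h1 _)]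

theorem continuousOn_sub_rpow {t : ℝ} (ht : t < 0) (δ : ℝ) :
    ContinuousOn (fun x : ℝ => (x - t) ^ δ) (uIcc 0 1) := by
  rw [uIcc_of_le zero_le_one]
  refine ContinuousOn.rpow_const (by fun_prop) fun x hx => Or.inl ?_
  linarith [hx.1]

theorem intervalIntegrable_eval_mul_rpow_mul_betaDensity {α β t : ℝ} (hα : 0 < α) (hβ : 0 < β)
    (ht : t < 0) (δ : ℝ) (F : ℝ[X]) :
    IntervalIntegrable (fun x => F.eval x * (x - t) ^ δ * betaDensity α β x) volume 0 1 :=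
  (intervalIntegrable_betaDensity hα hβ).continuousOn_mul
    ((F.continuous.continuousOn).mul (continuousOn_sub_rpow ht δ))

open Classical in
/-- The linear functional `F ↦ ∫₀¹ F(x) (x - t) ^ δ x ^ (α - 1) (1 - x) ^ (β - 1) dx`, set to zero
outside the range of parameters `0 < α`, `0 < β`, `t < 0`. -/
noncomputable def jacobiFunctional (α β δ t : ℝ) : ℝ[X] →ₗ[ℝ] ℝ :=
  if H : 0 < α ∧ 0 < β ∧ t < 0 then
    { toFun := fun F => ∫ x in (0 : ℝ)..1, F.eval x * (x - t) ^ δ * betaDensity α β x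
      map_add' := fun F G => by
        rw [← intervalIntegral.integral_add
          (intervalIntegrable_eval_mul_rpow_mul_betaDensity H.1 H.2.1 H.2.2 δ F)
          (intervalIntegrable_eval_mul_rpow_mul_betaDensity H.1 H.2.1 H.2.2 δ G)]
        simp only [eval_add, add_mul]
      map_smul' := fun c F => by
        simp only [eval_smul, smul_eq_mul, RingHom.id_apply, mul_assoc,
          intervalIntegral.integral_const_mul] }
  else 0

variable {α β γ t : ℝ}

theorem jacobiFunctional_apply (hα : 0 < α) (hβ : 0 < β) (ht : t < 0) (δ : ℝ) (F : ℝ[X]) :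
    jacobiFunctional α β δ t F
      = ∫ x in (0 : ℝ)..1, F.eval x * (x - t) ^ δ * betaDensity α β x := by
  simp [jacobiFunctional, hα, hβ, ht]

theorem jacobiFunctional_X_sub_C_mul (hα : 0 < α) (hβ : 0 < β) (ht : t < 0) (δ : ℝ) (F : ℝ[X]) :
    jacobiFunctional α β (δ - 1) t ((X - C t) * F) = jacobiFunctional α β δ t F := by
  rw [jacobiFunctional_apply hα hβ ht, jacobiFunctional_apply hα hβ ht]
  refine intervalIntegral.integral_congr_Ioo_of_le zero_le_one fun x hx => ?_
  have h0 : 0 < x - t := by linarith [hx.1]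
  simp only [eval_mul, eval_sub, eval_X, eval_C, rpow_sub_one h0.ne']
  field_simp

theorem hasDerivAt_jacobiFunctional (hα : 0 < α) (hβ : 0 < β) (ht : t < 0) (δ : ℝ) (F : ℝ[X]) :
    HasDerivAt (fun s => jacobiFunctional α β δ s F)
      (-δ * jacobiFunctional α β (δ - 1) t F) t := by
  have hs : Icc (2 * t) (t / 2) ∈ 𝓝 t := Icc_mem_nhds (by linarith) (by linarith)
  have hcont : ContinuousOn
      (fun p : ℝ × ℝ => F.eval p.2 * (-(δ * (p.2 - p.1) ^ (δ - 1))))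
      (Icc (2 * t) (t / 2) ×ˢ Icc (0 : ℝ) 1) := by
    refine (F.continuous.comp continuous_snd).continuousOn.mul
      (ContinuousOn.neg (continuousOn_const.mul
        (ContinuousOn.rpow_const (by fun_prop) fun p hp => Or.inl ?_)))
    have := hp.1.2; have := hp.2.1
    linarith
  obtain ⟨M, hM⟩ := (isCompact_Icc.prod isCompact_Icc).exists_bound_of_continuousOn hcont
  have key := intervalIntegral.hasDerivAt_integral_of_dominated_loc_of_deriv_le
    (μ := volume) (a := (0 : ℝ)) (b := 1) (x₀ := t) (s := Icc (2 * t) (t / 2))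
    (F := fun s x => F.eval x * (x - s) ^ δ * betaDensity α β x)
    (F' := fun s x => F.eval x * (-(δ * (x - s) ^ (δ - 1))) * betaDensity α β x)
    (bound := fun x => M * ‖betaDensity α β x‖) hs ?_
    (intervalIntegrable_eval_mul_rpow_mul_betaDensity hα hβ ht δ F) ?_ ?_ ?_ ?_
  · have e : (fun s => jacobiFunctional α β δ s F) =ᶠ[𝓝 t]
        fun s => ∫ x in (0 : ℝ)..1, F.eval x * (x - s) ^ δ * betaDensity α β x := by
      filter_upwards [eventually_lt_nhds ht] with s hs
      exact jacobiFunctional_apply hα hβ hs δ F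
    refine (key.2.congr_of_eventuallyEq e).congr_deriv ?_
    rw [jacobiFunctional_apply hα hβ ht, ← intervalIntegral.integral_const_mul]
    congr 1; ext x; ring
  · filter_upwards [eventually_lt_nhds ht] with s hs
    exact (intervalIntegrable_iff.1 (intervalIntegrable_eval_mul_rpow_mul_betaDensity hα hβ hs δ
      F)).aestronglyMeasurable
  · have := (intervalIntegrable_iff.1 ((intervalIntegrable_eval_mul_rpow_mul_betaDensity hα hβ ht
      (δ - 1) F).const_mul (-δ))).aestronglyMeasurable
    refine this.congr (Eventually.of_forall fun x => ?_)
    simp only; ring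
  · refine Eventually.of_forall fun x hx s hs => ?_
    rw [uIoc_of_le zero_le_one] at hx
    rw [norm_mul]
    exact mul_le_mul_of_nonneg_right (hM (s, x) ⟨hs, hx.1.le, hx.2⟩) (norm_nonneg _)
  · exact (intervalIntegrable_betaDensity hα hβ).norm.const_mul M
  · refine Eventually.of_forall fun x hx s hs => ?_
    rw [uIoc_of_le zero_le_one] at hx
    have h0 : x - s ≠ 0 := by have := hs.2; have := hx.1; linarith
    refine HasDerivAt.mul_const (HasDerivAt.const_mul _ ?_) _
    refine (((hasDerivAt_id s).const_sub x).rpow_const (p := δ) (Or.inl h0)).congr_deriv ?_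
    simp

theorem jacobiFunctional_derivative_add (hα : 0 < α) (hβ : 0 < β) (ht : t < 0) (F : ℝ[X]) :
    jacobiFunctional α β γ t (X * (1 - X) * derivative F)
      + γ * jacobiFunctional α β (γ - 1) t (X * (1 - X) * F)
      + α * jacobiFunctional α β γ t ((1 - X) * F)
      - β * jacobiFunctional α β γ t (X * F) = 0 := by
  have e : ∫ x in (0 : ℝ)..1,
      ((X * (1 - X) * derivative F + C α * ((1 - X) * F) - C β * (X * F)).eval x * (x - t) ^ γ
          * betaDensity α β x
        + (C γ * (X * (1 - X) * F)).eval x * (x - t) ^ (γ - 1) * betaDensity α β x)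
      = F.eval 1 * (1 - t) ^ γ * (1 ^ α * (1 - 1) ^ β)
        - F.eval 0 * (0 - t) ^ γ * (0 ^ α * (1 - 0) ^ β) := by
    refine intervalIntegral.integral_eq_sub_of_hasDerivAt_of_le
      (f := fun x => F.eval x * (x - t) ^ γ * (x ^ α * (1 - x) ^ β)) zero_le_one ?_ ?_ ?_
    · have h1 := continuousOn_sub_rpow ht γ
      rw [uIcc_of_le zero_le_one] at h1
      refine (F.continuous.continuousOn.mul h1).mul (ContinuousOn.mul ?_ ?_)
      · exact (continuous_id.rpow_const fun x => Or.inr hα.le).continuousOn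
      · exact ((continuous_const.sub continuous_id).rpow_const fun x => Or.inr hβ.le).continuousOn
    · intro x hx
      have h0 : x - t ≠ 0 := by have := hx.1; linarith
      have h1 : 1 - x ≠ 0 := by have := hx.2; linarith
      have h2 : x ≠ 0 := hx.1.ne'
      have d1 := ((hasDerivAt_id x).sub_const t).rpow_const (p := γ) (Or.inl h0)
      have d2 := (hasDerivAt_id x).rpow_const (p := α) (Or.inl h2)
      have d3 := ((hasDerivAt_id x).const_sub 1).rpow_const (p := β) (Or.inl h1)
      refine (((F.hasDerivAt x).mul d1).mul (d2.mul d3)).congr_deriv ?_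
      simp only [id, betaDensity, eval_add, eval_sub, eval_mul, eval_X, eval_C, eval_one,
        rpow_sub_one h0, rpow_sub_one h1, rpow_sub_one h2, Pi.mul_apply]
      field_simp
      ring
    · exact (intervalIntegrable_eval_mul_rpow_mul_betaDensity hα hβ ht _ _).add
        (intervalIntegrable_eval_mul_rpow_mul_betaDensity hα hβ ht _ _)
  rw [intervalIntegral.integral_add
    (intervalIntegrable_eval_mul_rpow_mul_betaDensity hα hβ ht _ _)
    (intervalIntegrable_eval_mul_rpow_mul_betaDensity hα hβ ht _ _),
    ← jacobiFunctional_apply hα hβ ht, ← jacobiFunctional_apply hα hβ ht] at e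
  simp only [map_sub, map_add, C_mul', map_smul, smul_eq_mul, sub_self, zero_rpow hα.ne',
    zero_rpow hβ.ne'] at e
  linarith

end JacobiFunctional

section MonicOrthogonal

open Polynomial

/-- `p` is the sequence of monic orthogonal polynomials of the functional `L`, with nonzero squared
norms `h`. -/
structure IsMonicOrthogonal (L : ℝ[X] →ₗ[ℝ] ℝ) (p : ℕ → ℝ[X]) (h : ℕ → ℝ) : Prop where
  monic : ∀ n, (p n).Monic
  natDegree_eq : ∀ n, (p n).natDegree = n
  ne_zero : ∀ n, h n ≠ 0
  apply_mul : ∀ m n, L (p m * p n) = if m = n then h n else 0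

theorem Polynomial.apply_C_mul {L : ℝ[X] →ₗ[ℝ] ℝ} (c : ℝ) (F : ℝ[X]) : L (C c * F) = c * L F := by
  rw [C_mul', map_smul, smul_eq_mul]

namespace IsMonicOrthogonal

variable {L : ℝ[X] →ₗ[ℝ] ℝ} {p : ℕ → ℝ[X]} {h : ℕ → ℝ}

theorem coeff_self (H : IsMonicOrthogonal L p h) (n : ℕ) : (p n).coeff n = 1 := by
  have := (H.monic n).coeff_natDegree
  rwa [H.natDegree_eq] at this

theorem coeff_of_lt (H : IsMonicOrthogonal L p h) {m n : ℕ} (hmn : n < m) : (p n).coeff m = 0 :=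
  coeff_eq_zero_of_natDegree_lt (by rwa [H.natDegree_eq])

theorem degree_eq (H : IsMonicOrthogonal L p h) (n : ℕ) : (p n).degree = n := by
  rw [degree_eq_natDegree (H.monic n).ne_zero, H.natDegree_eq]

theorem degree_sub_C_mul_lt (H : IsMonicOrthogonal L p h) {Q : ℝ[X]} {d : ℕ}
    (hQ : Q.degree < (d + 1 : ℕ)) : (Q - C (Q.coeff d) * p d).degree < d := by
  rw [degree_lt_iff_coeff_zero] at hQ ⊢
  intro m hm
  rw [coeff_sub, coeff_C_mul]
  rcases hm.eq_or_lt with rfl | hm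
  · rw [H.coeff_self]; ring
  · rw [H.coeff_of_lt hm, hQ m hm]; ring

theorem apply_mul_eq_zero (H : IsMonicOrthogonal L p h) {n : ℕ} {Q : ℝ[X]} (hQ : Q.degree < n) :
    L (p n * Q) = 0 := by
  suffices ∀ d ≤ n, ∀ Q : ℝ[X], Q.degree < d → L (p n * Q) = 0 from this n le_rfl Q hQ
  intro d
  induction d with
  | zero =>
    intro _ Q hQ
    have : Q = 0 := by
      rw [← degree_eq_bot]
      simpa using Nat.WithBot.lt_zero_iff.1 hQ
    simp [this]
  | succ d ih =>
    intro hd Q hQ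
    have h1 := ih (by omega) _ (H.degree_sub_C_mul_lt hQ)
    rw [mul_sub, map_sub, mul_left_comm, apply_C_mul, H.apply_mul, if_neg (by omega)] at h1
    linarith

theorem apply_mul_eq_coeff_mul (H : IsMonicOrthogonal L p h) {n : ℕ} {Q : ℝ[X]}
    (hQ : Q.degree < ((n + 1 : ℕ) : WithBot ℕ)) : L (p n * Q) = Q.coeff n * h n := by
  have h1 := H.apply_mul_eq_zero (H.degree_sub_C_mul_lt hQ)
  rw [mul_sub, map_sub, mul_left_comm, apply_C_mul, H.apply_mul, if_pos rfl] at h1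
  linarith

theorem eq_zero_of_apply_mul (H : IsMonicOrthogonal L p h) {n : ℕ} {S : ℝ[X]}
    (hS : S.degree < n) (hL : ∀ j < n, L (p j * S) = 0) : S = 0 := by
  induction n with
  | zero =>
    rw [← degree_eq_bot]
    simpa using Nat.WithBot.lt_zero_iff.1 hS
  | succ n ih =>
    have h1 := H.apply_mul_eq_coeff_mul hS
    rw [hL n (by omega)] at h1
    have h2 : S.coeff n = 0 := (mul_eq_zero.1 h1.symm).resolve_right (H.ne_zero n)
    refine ih ?_ fun j hj => hL j (by omega)
    have := H.degree_sub_C_mul_lt hS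
    simpa [h2] using this

theorem apply_succ_mul_eq_zero (H : IsMonicOrthogonal L p h) (n : ℕ) :
    L (p (n + 1) * p n) = 0 := by
  rw [H.apply_mul, if_neg (by omega)]

theorem apply_mul_self (H : IsMonicOrthogonal L p h) (n : ℕ) : L (p n * p n) = h n := by
  rw [H.apply_mul, if_pos rfl]

theorem sub_X_sub_C_mul_degree_lt (H : IsMonicOrthogonal L p h) (n : ℕ) (t : ℝ) :
    ((X - C t) * p n - p (n + 1)).degree < ((n + 1 : ℕ) : WithBot ℕ) := by
  have hm : ((X - C t) * p n).Monic := (monic_X_sub_C t).mul (H.monic n)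
  have hd : ((X - C t) * p n).degree = ((n + 1 : ℕ) : WithBot ℕ) := by
    rw [degree_mul, degree_X_sub_C, H.degree_eq]; push_cast; ring
  rw [← hd]
  refine Polynomial.degree_sub_lt_left (by rw [hd, H.degree_eq]) hm.ne_zero ?_
  rw [hm.leadingCoeff, (H.monic _).leadingCoeff]

section Resolvent

variable {K : ℝ[X] →ₗ[ℝ] ℝ} {a : ℝ}

theorem _root_.Polynomial.apply_mul_eq_eval_mul_add (hK : ∀ F, K ((X - C a) * F) = L F)
    (F G : ℝ[X]) : K (F * G) = G.eval a * K F + L (F * (G /ₘ (X - C a))) := by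
  conv_lhs => rw [← modByMonic_add_div G (X - C a), modByMonic_X_sub_C_eq_C_eval]
  rw [← hK, ← apply_C_mul, ← map_add]
  congr 1
  ring

theorem _root_.Polynomial.Monic.coeff_divByMonic_X_sub_C {G : ℝ[X]} (hG : G.Monic) {n : ℕ}
    (hn : G.natDegree = n + 1) : (G /ₘ (X - C a)).coeff n = 1 := by
  have h1 : (G /ₘ (X - C a)).natDegree = n := by
    rw [natDegree_divByMonic _ (monic_X_sub_C a), natDegree_X_sub_C, hn]; rfl
  have h2 := leadingCoeff_divByMonic_of_monic (monic_X_sub_C a) (p := G) (by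
    rw [degree_X_sub_C, degree_eq_natDegree hG.ne_zero, hn]; exact_mod_cast Nat.le_add_left 1 n)
  rw [hG.leadingCoeff, leadingCoeff, h1] at h2
  exact h2

theorem _root_.Polynomial.degree_divByMonic_X_sub_C_lt {G : ℝ[X]} {n : ℕ}
    (hn : G.natDegree ≤ n + 1) : (G /ₘ (X - C a)).degree < ((n + 1 : ℕ) : WithBot ℕ) := by
  refine lt_of_le_of_lt degree_le_natDegree ?_
  rw [natDegree_divByMonic _ (monic_X_sub_C a), natDegree_X_sub_C]
  exact_mod_cast (by omega : G.natDegree - 1 < n + 1)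

theorem resolvent_det (H : IsMonicOrthogonal L p h) (hK : ∀ F, K ((X - C a) * F) = L F) (n : ℕ) :
    K (p (n + 1) * p n) * (K (p (n + 1) * p n) - h n)
      = K (p (n + 1) * p (n + 1)) * K (p n * p n) := by
  have d0 : (p n /ₘ (X - C a)).degree < ((n + 1 : ℕ) : WithBot ℕ) :=
    degree_divByMonic_X_sub_C_lt (by rw [H.natDegree_eq]; omega)
  have d0' : L (p n * (p n /ₘ (X - C a))) = 0 := by
    rcases n with _ | n
    · have : p 0 /ₘ (X - C a) = 0 := by
        rw [divByMonic_eq_zero_iff (monic_X_sub_C a), H.degree_eq, degree_X_sub_C]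
        exact_mod_cast zero_lt_one
      rw [this, mul_zero, map_zero]
    · exact H.apply_mul_eq_zero (degree_divByMonic_X_sub_C_lt (by rw [H.natDegree_eq]))
  have d1 : (p (n + 1) /ₘ (X - C a)).degree < ((n + 1 : ℕ) : WithBot ℕ) :=
    degree_divByMonic_X_sub_C_lt (by rw [H.natDegree_eq])
  have e1 := apply_mul_eq_eval_mul_add hK (p (n + 1)) (p n)
  have e2 := apply_mul_eq_eval_mul_add hK (p n) (p (n + 1))
  have e3 := apply_mul_eq_eval_mul_add hK (p (n + 1)) (p (n + 1))
  have e4 := apply_mul_eq_eval_mul_add hK (p n) (p n)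
  rw [H.apply_mul_eq_zero d0] at e1
  rw [H.apply_mul_eq_coeff_mul d1, (H.monic _).coeff_divByMonic_X_sub_C (H.natDegree_eq _),
    mul_comm (p n)] at e2
  rw [H.apply_mul_eq_zero d1] at e3
  rw [d0'] at e4
  rw [e3, e4]
  nth_rewrite 1 [e1]
  rw [e2]
  ring

theorem X_sub_C_mul_eq (H : IsMonicOrthogonal L p h) (hK : ∀ F, K ((X - C a) * F) = L F)
    {n : ℕ} {γ : ℝ} {F D : ℝ[X]} (hF : ∀ Q : ℝ[X], Q.degree < n → L (F * Q) = 0)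
    (hD : D.degree < ((n + 1 : ℕ) : WithBot ℕ))
    (hDF : ∀ Q : ℝ[X], Q.degree < ((n + 1 : ℕ) : WithBot ℕ) → L (D * Q) = γ * K (F * Q)) :
    C (h n) * ((X - C a) * D)
      = C (γ * K (F * p n)) * p (n + 1) + C (γ * (L (F * p n) - K (F * p (n + 1)))) * p n := by
  rw [← sub_eq_zero]
  have hn1 : (p n).degree < ((n + 1 : ℕ) : WithBot ℕ) := by
    rw [H.degree_eq]; exact_mod_cast n.lt_succ_self
  have hXD : ((X - C a) * D).degree < ((n + 1 + 1 : ℕ) : WithBot ℕ) := by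
    rcases eq_or_ne D 0 with rfl | h0
    · simp
    rw [degree_mul, degree_X_sub_C]
    rw [degree_eq_natDegree h0] at hD ⊢
    norm_cast at hD ⊢
    omega
  have hcoeff : D.coeff n * h n = γ * K (F * p n) := by
    rw [← H.apply_mul_eq_coeff_mul hD, mul_comm (p n), hDF _ hn1]
  refine H.eq_zero_of_apply_mul (n := n + 1 + 1) ?_ fun j hj => ?_
  · have d1 : ∀ c d : ℝ,
        (C c * p (n + 1) + C d * p n).degree < ((n + 1 + 1 : ℕ) : WithBot ℕ) := fun c d => by
      rw [degree_lt_iff_coeff_zero]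
      intro m hm
      simp [H.coeff_of_lt (show n < m by omega), H.coeff_of_lt (show n + 1 < m by omega)]
    refine lt_of_le_of_lt (degree_sub_le _ _) (max_lt ?_ (d1 _ _))
    rw [C_mul']
    exact lt_of_le_of_lt (degree_smul_le _ _) hXD
  · rw [mul_sub, mul_add, map_sub, map_add, mul_left_comm, mul_left_comm (p j) (C _) (p (n + 1)),
      mul_left_comm (p j) (C _) (p n), apply_C_mul, apply_C_mul, apply_C_mul, H.apply_mul,
      H.apply_mul]
    rcases (by omega : j = n + 1 ∨ j = n ∨ j < n) with rfl | rfl | hj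
    · rw [if_pos rfl, if_neg (by omega), H.apply_mul_eq_coeff_mul hXD, sub_mul, coeff_sub,
        coeff_X_mul, coeff_C_mul, (degree_lt_iff_coeff_zero _ _).1 hD _ le_rfl]
      linear_combination h (n + 1) * hcoeff
    · rw [if_neg (by omega), if_pos rfl]
      have e1 := hDF _ (H.sub_X_sub_C_mul_degree_lt j a)
      rw [mul_sub, mul_sub, map_sub, map_sub, mul_comm D (p (j + 1)), H.apply_mul_eq_zero hD,
        mul_left_comm F, hK] at e1
      have e2 : p j * ((X - C a) * D) = D * ((X - C a) * p j) := by ring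
      rw [e2]
      linear_combination h j * e1
    · rw [if_neg (by omega), if_neg (by omega)]
      have e1 := hDF ((X - C a) * p j) (by
        rw [degree_mul, degree_X_sub_C, H.degree_eq]; exact_mod_cast (by omega : 1 + j < n + 1))
      rw [mul_left_comm F, hK, hF _ (by rw [H.degree_eq]; exact_mod_cast hj)] at e1
      have e2 : p j * ((X - C a) * D) = D * ((X - C a) * p j) := by ring
      rw [e2, e1]
      ring

end Resolvent

section Pearson

variable {K0 K1 Kt : ℝ[X] →ₗ[ℝ] ℝ} {α β γ t : ℝ}

theorem degree_derivative_lt (H : IsMonicOrthogonal L p h) (n : ℕ) :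
    (derivative (p n)).degree < n := by
  rw [← H.degree_eq n]
  exact Polynomial.degree_derivative_lt (H.monic n).ne_zero

theorem pearson_self (H : IsMonicOrthogonal L p h)
    (hP : ∀ F, L (derivative F) + γ * Kt F + α * K0 F + β * K1 F = 0) (n : ℕ) :
    γ * Kt (p n * p n) + α * K0 (p n * p n) + β * K1 (p n * p n) = 0 := by
  have e := hP (p n * p n)
  rw [derivative_mul, map_add, mul_comm (derivative _),
    H.apply_mul_eq_zero (H.degree_derivative_lt n)] at e
  linarith

theorem pearson_succ (H : IsMonicOrthogonal L p h)
    (hP : ∀ F, L (derivative F) + γ * Kt F + α * K0 F + β * K1 F = 0) (n : ℕ) :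
    (n + 1) * h n + γ * Kt (p (n + 1) * p n) + α * K0 (p (n + 1) * p n)
      + β * K1 (p (n + 1) * p n) = 0 := by
  have e := hP (p (n + 1) * p n)
  have hd : (derivative (p n)).degree < ((n + 1 : ℕ) : WithBot ℕ) :=
    (H.degree_derivative_lt n).trans (by exact_mod_cast n.lt_succ_self)
  rw [derivative_mul, map_add, mul_comm (derivative _),
    H.apply_mul_eq_coeff_mul (H.degree_derivative_lt (n + 1)), H.apply_mul_eq_zero hd,
    coeff_derivative, H.coeff_self] at e
  linarith

theorem pearson_X_mul_self (H : IsMonicOrthogonal L p h)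
    (hK0 : ∀ F, K0 (X * F) = L F) (hK1 : ∀ F, K1 ((X - C 1) * F) = L F)
    (hKt : ∀ F, Kt ((X - C t) * F) = L F)
    (hP : ∀ F, L (derivative F) + γ * Kt F + α * K0 F + β * K1 F = 0) (n : ℕ) :
    (2 * n + 1 + α + β + γ) * h n + γ * t * Kt (p n * p n) + β * K1 (p n * p n) = 0 := by
  have e := hP (X * (p n * p n))
  have e0 : derivative (X * (p n * p n)) = p n * p n + C 2 * (p n * (X * derivative (p n))) := by
    simp only [derivative_mul, derivative_X]
    rw [show (C 2 : ℝ[X]) = 2 from rfl]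
    ring
  have e1 : X * (p n * p n) = (X - C 1) * (p n * p n) + C 1 * (p n * p n) := by ring
  have e2 : X * (p n * p n) = (X - C t) * (p n * p n) + C t * (p n * p n) := by ring
  have hd : (X * derivative (p n)).degree < ((n + 1 : ℕ) : WithBot ℕ) := by
    rw [degree_lt_iff_coeff_zero]
    intro m hm
    obtain ⟨m, rfl⟩ : ∃ k, m = k + 1 := ⟨m - 1, by omega⟩
    rw [coeff_X_mul, coeff_derivative, H.coeff_of_lt (by omega), zero_mul]
  have hc : (X * derivative (p n)).coeff n = (n : ℝ) := by
    rcases n with _ | n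
    · simp
    · rw [coeff_X_mul, coeff_derivative, H.coeff_self]; push_cast; ring
  rw [hK0, e0, map_add, apply_C_mul, H.apply_mul_eq_coeff_mul hd, hc] at e
  nth_rewrite 1 [e2] at e
  rw [e1, map_add, map_add, apply_C_mul, apply_C_mul, hK1, hKt, H.apply_mul_self] at e
  linarith

end Pearson

end IsMonicOrthogonal

end MonicOrthogonal

section MovingFunctional

open Polynomial Filter Topology

/-- The coefficients of the polynomial-valued function `F` are differentiable at `t`, with
derivatives the coefficients of `D`. -/
def CoeffHasDerivAt (F : ℝ → ℝ[X]) (D : ℝ[X]) (t : ℝ) : Prop :=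
  ∀ i, HasDerivAt (fun s => (F s).coeff i) (D.coeff i) t

namespace CoeffHasDerivAt

variable {F G : ℝ → ℝ[X]} {D E : ℝ[X]} {t : ℝ}

theorem const (Q : ℝ[X]) (t : ℝ) : CoeffHasDerivAt (fun _ => Q) 0 t := fun i => by
  simpa using hasDerivAt_const t (Q.coeff i)

theorem mul (hF : CoeffHasDerivAt F D t) (hG : CoeffHasDerivAt G E t) :
    CoeffHasDerivAt (fun s => F s * G s) (D * G t + F t * E) t := fun i => by
  simp only [coeff_add, coeff_mul, ← Finset.sum_add_distrib]
  exact HasDerivAt.fun_sum fun x _ => (hF x.1).mul (hG x.2)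

theorem natDegree_le (hF : CoeffHasDerivAt F D t) {N : ℕ}
    (hN : ∀ᶠ s in 𝓝 t, (F s).natDegree ≤ N) : D.natDegree ≤ N := by
  rw [natDegree_le_iff_coeff_eq_zero]
  intro i hi
  refine (hF i).unique ((hasDerivAt_const t (0 : ℝ)).congr_of_eventuallyEq ?_)
  filter_upwards [hN] with s hs
  exact coeff_eq_zero_of_natDegree_lt (hs.trans_lt hi)

theorem apply (hF : CoeffHasDerivAt F D t) {N : ℕ} (hN : ∀ᶠ s in 𝓝 t, (F s).natDegree ≤ N)
    {L : ℝ → ℝ[X] →ₗ[ℝ] ℝ} {L' : ℝ[X] →ₗ[ℝ] ℝ}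
    (hL : ∀ Q, HasDerivAt (fun s => L s Q) (L' Q) t) :
    HasDerivAt (fun s => L s (F s)) (L t D + L' (F t)) t := by
  have expand : ∀ (Λ : ℝ[X] →ₗ[ℝ] ℝ) (Q : ℝ[X]), Q.natDegree ≤ N →
      Λ Q = ∑ i ∈ Finset.range (N + 1), Q.coeff i * Λ (X ^ i) := fun Λ Q hQ => by
    conv_lhs => rw [Q.as_sum_range_C_mul_X_pow' (Nat.lt_succ_of_le hQ)]
    rw [map_sum]
    exact Finset.sum_congr rfl fun i _ => apply_C_mul _ _
  have e : (fun s => L s (F s)) =ᶠ[𝓝 t]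
      fun s => ∑ i ∈ Finset.range (N + 1), (F s).coeff i * L s (X ^ i) := by
    filter_upwards [hN] with s hs
    exact expand _ _ hs
  refine HasDerivAt.congr_of_eventuallyEq ?_ e
  rw [expand (L t) D (hF.natDegree_le hN), expand L' (F t) hN.self_of_nhds,
    ← Finset.sum_add_distrib]
  exact HasDerivAt.fun_sum fun i _ => (hF i).mul (hL _)

end CoeffHasDerivAt

namespace IsMonicOrthogonal

theorem eq_X_pow_sub_sum {L : ℝ[X] →ₗ[ℝ] ℝ} {p : ℕ → ℝ[X]} {h : ℕ → ℝ}
    (H : IsMonicOrthogonal L p h) (n : ℕ) :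
    p n = X ^ n - ∑ k ∈ Finset.range n, C (L (p k * X ^ n) / h k) * p k := by
  rw [← sub_eq_zero]
  refine H.eq_zero_of_apply_mul (n := n) ?_ fun j hj => ?_
  · rw [degree_lt_iff_coeff_zero]
    intro m hm
    have hs : (∑ k ∈ Finset.range n, C (L (p k * X ^ n) / h k) * p k).coeff m = 0 := by
      rw [finsetSum_coeff]
      refine Finset.sum_eq_zero fun k hk => ?_
      rw [coeff_C_mul, H.coeff_of_lt ((Finset.mem_range.1 hk).trans_le hm), mul_zero]
    rw [coeff_sub, coeff_sub, hs, coeff_X_pow]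
    rcases hm.eq_or_lt with rfl | hm
    · rw [H.coeff_self]; simp
    · rw [H.coeff_of_lt hm, if_neg (by omega)]; simp
  · have hs : L (p j * ∑ k ∈ Finset.range n, C (L (p k * X ^ n) / h k) * p k)
        = L (p j * X ^ n) := by
      rw [Finset.mul_sum, map_sum, Finset.sum_eq_single j]
      · rw [mul_left_comm, apply_C_mul, H.apply_mul_self, div_mul_cancel₀ _ (H.ne_zero j)]
      · intro k _ hk
        rw [mul_left_comm, apply_C_mul, H.apply_mul, if_neg hk.symm, mul_zero]
      · exact fun hj' => absurd (Finset.mem_range.2 hj) hj'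
    rw [mul_sub, mul_sub, map_sub, map_sub, hs, H.apply_mul, if_neg (by omega)]
    ring

variable {L : ℝ → ℝ[X] →ₗ[ℝ] ℝ} {L' : ℝ[X] →ₗ[ℝ] ℝ} {p : ℝ → ℕ → ℝ[X]} {h : ℝ → ℕ → ℝ} {t : ℝ}

theorem eventually_natDegree_le (H : ∀ᶠ s in 𝓝 t, IsMonicOrthogonal (L s) (p s) (h s)) (n : ℕ) :
    ∀ᶠ s in 𝓝 t, (p s n).natDegree ≤ n := by
  filter_upwards [H] with s hs
  rw [hs.natDegree_eq]

theorem eventually_natDegree_mul_le (H : ∀ᶠ s in 𝓝 t, IsMonicOrthogonal (L s) (p s) (h s))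
    (m : ℕ) (Q : ℝ → ℝ[X]) (n : ℕ) (hQ : ∀ᶠ s in 𝓝 t, (Q s).natDegree ≤ n) :
    ∀ᶠ s in 𝓝 t, (p s m * Q s).natDegree ≤ m + n := by
  filter_upwards [eventually_natDegree_le H m, hQ] with s h1 h2
  exact natDegree_mul_le.trans (add_le_add h1 h2)

theorem hasDerivAt_norm (H : ∀ᶠ s in 𝓝 t, IsMonicOrthogonal (L s) (p s) (h s))
    (hL : ∀ Q, HasDerivAt (fun s => L s Q) (L' Q) t) {n : ℕ} {D : ℝ[X]}
    (hD : CoeffHasDerivAt (fun s => p s n) D t) (hdeg : D.degree < n) :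
    HasDerivAt (fun s => h s n) (L' (p t n * p t n)) t := by
  have h1 := (hD.mul hD).apply
    (eventually_natDegree_mul_le H n _ n (eventually_natDegree_le H n)) hL
  have e : (fun s => h s n) =ᶠ[𝓝 t] fun s => L s (p s n * p s n) := by
    filter_upwards [H] with s hs
    rw [hs.apply_mul_self]
  refine (h1.congr_of_eventuallyEq e).congr_deriv ?_
  rw [map_add, mul_comm D, H.self_of_nhds.apply_mul_eq_zero hdeg]
  ring

theorem exists_coeffHasDerivAt (H : ∀ᶠ s in 𝓝 t, IsMonicOrthogonal (L s) (p s) (h s))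
    (hL : ∀ Q, HasDerivAt (fun s => L s Q) (L' Q) t) (n : ℕ) :
    ∃ D : ℝ[X], D.degree < n ∧ CoeffHasDerivAt (fun s => p s n) D t := by
  induction n using Nat.strong_induction_on with
  | _ n ih =>
    have hdiff : ∀ i, DifferentiableAt ℝ (fun s => (p s n).coeff i) t := fun i => by
      have e : (fun s => (p s n).coeff i) =ᶠ[𝓝 t] fun s => (X ^ n : ℝ[X]).coeff i
          - ∑ k ∈ Finset.range n, L s (p s k * X ^ n) / h s k * (p s k).coeff i := by
        filter_upwards [H] with s hs
        conv_lhs => rw [hs.eq_X_pow_sub_sum n]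
        simp only [coeff_sub, finsetSum_coeff, coeff_C_mul]
      refine DifferentiableAt.congr_of_eventuallyEq ?_ e
      refine (differentiableAt_const _).sub (DifferentiableAt.fun_sum fun k hk => ?_)
      obtain ⟨D, hdeg, hD⟩ := ih k (Finset.mem_range.1 hk)
      have h1 := (hD.mul (CoeffHasDerivAt.const (X ^ n) t)).apply
        (eventually_natDegree_mul_le H k (fun _ => X ^ n) n
          (Eventually.of_forall fun _ => natDegree_X_pow_le n)) hL
      exact (h1.differentiableAt.div (hasDerivAt_norm H hL hD hdeg).differentiableAt
        (H.self_of_nhds.ne_zero k)).mul (hD i).differentiableAt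
    refine ⟨∑ i ∈ Finset.range n, C (deriv (fun s => (p s n).coeff i) t) * X ^ i, ?_, fun i => ?_⟩
    · rw [degree_lt_iff_coeff_zero]
      intro m hm
      simp only [finsetSum_coeff, coeff_C_mul_X_pow]
      refine Finset.sum_eq_zero fun k hk => if_neg ?_
      have := Finset.mem_range.1 hk
      omega
    · simp only [finsetSum_coeff, coeff_C_mul_X_pow, Finset.sum_ite_eq, Finset.mem_range]
      split_ifs with hi
      · exact (hdiff i).hasDerivAt
      · refine (hasDerivAt_const t ((X ^ n : ℝ[X]).coeff i)).congr_of_eventuallyEq ?_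
        filter_upwards [H] with s hs
        rw [coeff_X_pow]
        rcases (not_lt.1 hi).eq_or_lt with rfl | hi
        · rw [hs.coeff_self, if_pos rfl]
        · rw [hs.coeff_of_lt hi, if_neg (by omega)]

theorem apply_coeffDeriv_mul (H : ∀ᶠ s in 𝓝 t, IsMonicOrthogonal (L s) (p s) (h s))
    (hL : ∀ Q, HasDerivAt (fun s => L s Q) (L' Q) t) {n : ℕ} {D Q : ℝ[X]}
    (hD : CoeffHasDerivAt (fun s => p s n) D t) (hQ : Q.degree < n) :
    L t (D * Q) = -L' (p t n * Q) := by
  have h1 := (hD.mul (CoeffHasDerivAt.const Q t)).apply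
    (eventually_natDegree_mul_le H n (fun _ => Q) Q.natDegree (Eventually.of_forall fun _ => le_rfl))
    hL
  have e : (fun s => L s (p s n * Q)) =ᶠ[𝓝 t] fun _ => 0 := by
    filter_upwards [H] with s hs
    exact hs.apply_mul_eq_zero hQ
  have h2 := h1.unique ((hasDerivAt_const t (0 : ℝ)).congr_of_eventuallyEq e)
  rw [mul_zero, add_zero] at h2
  linarith

theorem hasDerivAt_resolvent_div_norm {K1 : ℝ → ℝ[X] →ₗ[ℝ] ℝ} {Kt : ℝ[X] →ₗ[ℝ] ℝ} {γ : ℝ}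
    (ht : t ≠ 1) (H : ∀ᶠ s in 𝓝 t, IsMonicOrthogonal (L s) (p s) (h s))
    (hKt : ∀ F, Kt ((X - C t) * F) = L t F) (hK1 : ∀ F, K1 t ((X - C 1) * F) = L t F)
    (hL : ∀ Q, HasDerivAt (fun s => L s Q) (-γ * Kt Q) t)
    (hK1' : ∀ Q, HasDerivAt (fun s => K1 s Q) (-γ / (1 - t) * (K1 t Q - Kt Q)) t) (n : ℕ) :
    HasDerivAt (fun s => K1 s (p s (n + 1) * p s n) / h s n)
      (γ * (Kt (p t n * p t n) * K1 t (p t (n + 1) * p t (n + 1))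
        - Kt (p t (n + 1) * p t (n + 1)) * K1 t (p t n * p t n)) / ((1 - t) * h t n ^ 2)) t := by
  have Ht := H.self_of_nhds
  have hL' : ∀ Q, HasDerivAt (fun s => L s Q) ((-γ • Kt) Q) t := hL
  have hK1'' : ∀ Q, HasDerivAt (fun s => K1 s Q) (((-γ / (1 - t)) • (K1 t - Kt)) Q) t := hK1'
  obtain ⟨D, hdD, hD⟩ := exists_coeffHasDerivAt H hL' (n + 1)
  obtain ⟨E, hdE, hE⟩ := exists_coeffHasDerivAt H hL' n
  have h0 : h t n ≠ 0 := Ht.ne_zero n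
  have ht' : 1 - t ≠ 0 := sub_ne_zero.2 ht.symm
  have hh := hasDerivAt_norm H hL' hE hdE
  have hA := (hD.mul hE).apply
    (eventually_natDegree_mul_le H (n + 1) _ n (eventually_natDegree_le H n)) hK1''
  have shift : ∀ F : ℝ[X], (1 - t) * K1 t F
      = K1 t ((X - C t) * F) - Kt ((X - C t) * F) := fun F => by
    rw [show (X - C t) * F = (X - C 1) * F + C (1 - t) * F by rw [C_sub]; ring, map_add, hK1,
      apply_C_mul, show (X - C 1) * F + C (1 - t) * F = (X - C t) * F by rw [C_sub]; ring, hKt]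
    ring
  have eD := Ht.X_sub_C_mul_eq hKt (γ := γ) (F := p t (n + 1)) (D := D) (n := n)
    (fun Q hQ => Ht.apply_mul_eq_zero (hQ.trans (by exact_mod_cast n.lt_succ_self))) hdD
    (fun Q hQ => by
      rw [apply_coeffDeriv_mul H hL' hD hQ, LinearMap.smul_apply, smul_eq_mul]; ring)
  have hpn : (p t n).degree < ((n + 1 : ℕ) : WithBot ℕ) := by
    rw [Ht.degree_eq]; exact_mod_cast n.lt_succ_self
  set c := γ * Kt (p t n * p t n) / h t n with hc
  have eE := Ht.X_sub_C_mul_eq hKt (γ := γ) (F := p t n) (D := E + C c * p t n) (n := n)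
    (fun Q hQ => Ht.apply_mul_eq_zero hQ)
    (by
      refine lt_of_le_of_lt (degree_add_le _ _) (max_lt ?_ ?_)
      · exact hdE.trans (by exact_mod_cast n.lt_succ_self)
      · rw [C_mul']
        exact lt_of_le_of_lt (degree_smul_le _ _) hpn)
    (fun Q hQ => by
      have h1 := apply_coeffDeriv_mul H hL' hE (Ht.degree_sub_C_mul_lt hQ)
      have h2 : L t (E * p t n) = 0 := by rw [mul_comm, Ht.apply_mul_eq_zero hdE]
      rw [LinearMap.smul_apply, smul_eq_mul, mul_sub, mul_sub, map_sub, map_sub, mul_left_comm,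
        mul_left_comm (p t n), apply_C_mul, apply_C_mul, h2] at h1
      rw [add_mul, mul_assoc, map_add, apply_C_mul, Ht.apply_mul_eq_coeff_mul hQ, hc]
      field_simp
      linarith)
  rw [Ht.apply_succ_mul_eq_zero] at eD
  rw [Ht.apply_mul_self] at eE
  have s1 : (1 - t) * (h t n * K1 t (D * p t n))
      = γ * Kt (p t (n + 1) * p t n) * (K1 t (p t (n + 1) * p t n) - Kt (p t (n + 1) * p t n))
        - γ * Kt (p t (n + 1) * p t (n + 1)) * (K1 t (p t n * p t n) - Kt (p t n * p t n)) := by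
    rw [← apply_C_mul, shift,
      show (X - C t) * (C (h t n) * (D * p t n)) = C (h t n) * ((X - C t) * D) * p t n by ring,
      eD, add_mul, mul_assoc, mul_assoc, map_add, map_add]
    simp only [apply_C_mul]
    ring
  have s2 : (1 - t) * (h t n * (K1 t (p t (n + 1) * E) + c * K1 t (p t (n + 1) * p t n)))
      = γ * Kt (p t n * p t n)
          * (K1 t (p t (n + 1) * p t (n + 1)) - Kt (p t (n + 1) * p t (n + 1)))
        + γ * (h t n - Kt (p t (n + 1) * p t n))
          * (K1 t (p t (n + 1) * p t n) - Kt (p t (n + 1) * p t n)) := by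
    rw [← apply_C_mul c, ← map_add, ← apply_C_mul, shift,
      show (X - C t) * (C (h t n) * (p t (n + 1) * E + C c * (p t (n + 1) * p t n)))
        = C (h t n) * ((X - C t) * (E + C c * p t n)) * p t (n + 1) by ring,
      eE, add_mul, mul_assoc, mul_assoc, map_add, map_add, mul_comm (p t n) (p t (n + 1))]
    simp only [apply_C_mul]
    ring
  refine (hA.div hh h0).congr_deriv ?_
  simp only [LinearMap.smul_apply, LinearMap.sub_apply, smul_eq_mul, map_add]
  rw [hc] at s2
  field_simp at s2 ⊢
  linear_combination s1 + s2

end IsMonicOrthogonal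

end MovingFunctional

section JacobiResolvents

open Polynomial

/-- Integration of polynomials against the weight `(x - t) ^ γ * x ^ α * (1 - x) ^ β`. -/
noncomputable def weightFunctional (α β γ t : ℝ) : ℝ[X] →ₗ[ℝ] ℝ :=
  jacobiFunctional α β γ t ∘ₗ LinearMap.mulLeft ℝ (X * (1 - X))

/-- Integration of polynomials against the weight divided by `x`. -/
noncomputable def zeroResolvent (α β γ t : ℝ) : ℝ[X] →ₗ[ℝ] ℝ :=
  jacobiFunctional α β γ t ∘ₗ LinearMap.mulLeft ℝ (1 - X)

/-- Integration of polynomials against the weight divided by `x - 1`. -/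
noncomputable def oneResolvent (α β γ t : ℝ) : ℝ[X] →ₗ[ℝ] ℝ :=
  -(jacobiFunctional α β γ t ∘ₗ LinearMap.mulLeft ℝ X)

/-- Integration of polynomials against the weight divided by `x - t`. -/
noncomputable def paramResolvent (α β γ t : ℝ) : ℝ[X] →ₗ[ℝ] ℝ :=
  jacobiFunctional α β (γ - 1) t ∘ₗ LinearMap.mulLeft ℝ (X * (1 - X))

variable {α β γ t : ℝ}

theorem genJacobiWeight_eq_betaDensity {x : ℝ} (hx : x ∈ Set.Ioo (0 : ℝ) 1) :
    genJacobiWeight α β γ t x = x * (1 - x) * (x - t) ^ γ * betaDensity α β x := by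
  have h0 : x ≠ 0 := hx.1.ne'
  have h1 : 1 - x ≠ 0 := by have := hx.2; linarith
  rw [genJacobiWeight, betaDensity, rpow_sub_one h0, rpow_sub_one h1]
  field_simp

theorem weightFunctional_apply (hα : 0 < α) (hβ : 0 < β) (ht : t < 0) (F : ℝ[X]) :
    weightFunctional α β γ t F = ∫ x in (0 : ℝ)..1, F.eval x * genJacobiWeight α β γ t x := by
  rw [weightFunctional, LinearMap.comp_apply, LinearMap.mulLeft_apply,
    jacobiFunctional_apply hα hβ ht]
  refine intervalIntegral.integral_congr_Ioo_of_le zero_le_one fun x hx => ?_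
  simp only [genJacobiWeight_eq_betaDensity hx, eval_mul, eval_sub, eval_X, eval_one]
  ring

theorem zeroResolvent_apply (hα : 0 < α) (hβ : 0 < β) (ht : t < 0) (F : ℝ[X]) :
    zeroResolvent α β γ t F = ∫ x in (0 : ℝ)..1, F.eval x * genJacobiWeight α β γ t x / x := by
  rw [zeroResolvent, LinearMap.comp_apply, LinearMap.mulLeft_apply,
    jacobiFunctional_apply hα hβ ht]
  refine intervalIntegral.integral_congr_Ioo_of_le zero_le_one fun x hx => ?_
  have h0 : x ≠ 0 := hx.1.ne'
  simp only [genJacobiWeight_eq_betaDensity hx, eval_mul, eval_sub, eval_X, eval_one]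
  field_simp

theorem oneResolvent_apply (hα : 0 < α) (hβ : 0 < β) (ht : t < 0) (F : ℝ[X]) :
    oneResolvent α β γ t F
      = -∫ x in (0 : ℝ)..1, F.eval x * genJacobiWeight α β γ t x / (1 - x) := by
  rw [oneResolvent, LinearMap.neg_apply, LinearMap.comp_apply, LinearMap.mulLeft_apply,
    jacobiFunctional_apply hα hβ ht]
  congr 1
  refine intervalIntegral.integral_congr_Ioo_of_le zero_le_one fun x hx => ?_
  have h1 : 1 - x ≠ 0 := by have := hx.2; linarith
  simp only [genJacobiWeight_eq_betaDensity hx, eval_mul, eval_X]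
  field_simp

theorem zeroResolvent_X_mul (F : ℝ[X]) :
    zeroResolvent α β γ t (X * F) = weightFunctional α β γ t F := by
  simp only [zeroResolvent, weightFunctional, LinearMap.comp_apply, LinearMap.mulLeft_apply]
  congr 1
  ring

theorem oneResolvent_X_sub_C_mul (F : ℝ[X]) :
    oneResolvent α β γ t ((X - C 1) * F) = weightFunctional α β γ t F := by
  simp only [oneResolvent, weightFunctional, LinearMap.comp_apply, LinearMap.mulLeft_apply,
    LinearMap.neg_apply, ← map_neg, C_1]
  congr 1
  ring

theorem paramResolvent_X_sub_C_mul (hα : 0 < α) (hβ : 0 < β) (ht : t < 0) (F : ℝ[X]) :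
    paramResolvent α β γ t ((X - C t) * F) = weightFunctional α β γ t F := by
  simp only [paramResolvent, weightFunctional, LinearMap.comp_apply, LinearMap.mulLeft_apply]
  rw [mul_left_comm, jacobiFunctional_X_sub_C_mul hα hβ ht]

theorem weightFunctional_derivative (hα : 0 < α) (hβ : 0 < β) (ht : t < 0) (F : ℝ[X]) :
    weightFunctional α β γ t (derivative F) + γ * paramResolvent α β γ t F
      + α * zeroResolvent α β γ t F + β * oneResolvent α β γ t F = 0 := by
  have := jacobiFunctional_derivative_add (γ := γ) hα hβ ht F
  simp only [paramResolvent, weightFunctional, zeroResolvent, oneResolvent, LinearMap.comp_apply,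
    LinearMap.mulLeft_apply, LinearMap.neg_apply]
  linarith

theorem hasDerivAt_weightFunctional (hα : 0 < α) (hβ : 0 < β) (ht : t < 0) (F : ℝ[X]) :
    HasDerivAt (fun s => weightFunctional α β γ s F) (-γ * paramResolvent α β γ t F) t :=
  hasDerivAt_jacobiFunctional hα hβ ht γ (X * (1 - X) * F)

theorem hasDerivAt_oneResolvent (hα : 0 < α) (hβ : 0 < β) (ht : t < 0) (F : ℝ[X]) :
    HasDerivAt (fun s => oneResolvent α β γ s F)
      (-γ / (1 - t) * (oneResolvent α β γ t F - paramResolvent α β γ t F)) t := by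
  refine (hasDerivAt_jacobiFunctional hα hβ ht γ (X * F)).neg.congr_deriv ?_
  have ht' : 1 - t ≠ 0 := by linarith
  have e : oneResolvent α β γ t F - paramResolvent α β γ t F
      = -((1 - t) * jacobiFunctional α β (γ - 1) t (X * F)) := by
    simp only [oneResolvent, paramResolvent, LinearMap.comp_apply, LinearMap.mulLeft_apply,
      LinearMap.neg_apply]
    rw [← jacobiFunctional_X_sub_C_mul hα hβ ht, ← apply_C_mul, ← map_neg, ← map_neg, ← map_sub]
    congr 1
    rw [C_sub, C_1]
    ring
  rw [e]
  field_simp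

end JacobiResolvents

/-- The algebra that turns the determinant identities at `0`, `1`, `t`, the Pearson identities and
the derivative of `r` into the two representations of `R`. -/
theorem representations_of_determinant_identities {α β γ t b R R' T T' r rs d : ℝ} {n : ℕ}
    (h1 : r ^ 2 + β * r = b * R * R') (h0 : rs ^ 2 - α * rs = b * (R - T) * (R' - T'))
    (ht : (r - rs - n) ^ 2 - γ * (r - rs - n) = b * T * T')
    (hσ : 2 * n + 1 + α + β + γ = R - t * T) (hσ' : 2 * n + 1 + α + β + γ - 2 = R' - t * T')
    (hd : (1 - t) * d = b * (T' * R - T * R'))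
    (hk : kAux α β γ n r rs t ≠ 0) (hr : (β + r) * r ≠ 0) (hR : R ≠ 0) :
    R = (2 * n + 1 + α + β + γ) * (lAux α β γ n r rs t - t * (1 - t) * d)
        / (2 * kAux α β γ n r rs t) ∧
    R⁻¹ = (lAux α β γ n r rs t + t * (1 - t) * d)
        / (2 * (2 * n + 1 + α + β + γ) * ((β + r) * r)) ∧
    t ^ 2 * (t - 1) ^ 2 * d ^ 2
      = lAux α β γ n r rs t ^ 2 - 4 * kAux α β γ n r rs t * ((β + r) * r) := by
  set σ := 2 * n + 1 + α + β + γ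
  have ek : kAux α β γ n r rs t = b * σ * (σ - 2) := by
    rw [hσ', hσ, kAux]
    linear_combination (1 - t) * h1 + (t ^ 2 - t) * ht + t * h0
  have el : lAux α β γ n r rs t = b * ((σ - 2) * R + σ * R') := by
    rw [hσ', hσ, lAux]
    linear_combination (2 - t) * h1 - t * ht + t * h0
  have ed : t * (1 - t) * d = b * (σ * R' - (σ - 2) * R) := by
    rw [hσ', hσ]
    linear_combination t * hd
  have er : (β + r) * r = b * R * R' := by linear_combination h1
  have hσ0 : σ ≠ 0 := by
    intro h
    rw [ek, h] at hk
    simp at hk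
  refine ⟨?_, ?_, ?_⟩
  · rw [eq_div_iff (mul_ne_zero two_ne_zero hk), ek, el, ed]
    ring
  · rw [inv_eq_one_div, div_eq_div_iff hR (mul_ne_zero (mul_ne_zero two_ne_zero hσ0) hr), er, el,
      ed]
    ring
  · rw [show t ^ 2 * (t - 1) ^ 2 * d ^ 2 = (t * (1 - t) * d) ^ 2 by ring, ed, el, ek, er]
    ring

theorem statement19
    (α β γ : ℝ) (hα : 0 < α) (hβ : 0 < β)
    (P : ℝ → ℕ → Polynomial ℝ) (h : ℝ → ℕ → ℝ)
    (hmonic : ∀ t < (0:ℝ), ∀ n, (P t n).Monic ∧ (P t n).natDegree = n)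
    (hpos : ∀ t < (0:ℝ), ∀ n, 0 < h t n)
    (horth : ∀ t < (0:ℝ), ∀ m n, (∫ x in (0:ℝ)..1,
        (P t m).eval x * (P t n).eval x * genJacobiWeight α β γ t x)
      = if m = n then h t n else 0)
    (R r rs : ℝ → ℕ → ℝ)
    (hR : ∀ t < (0:ℝ), ∀ n, R t n = β / h t n *
      ∫ y in (0:ℝ)..1, ((P t n).eval y) ^ 2 * genJacobiWeight α β γ t y / (1 - y))
    (hr : ∀ t < (0:ℝ), ∀ n, 1 ≤ n → r t n = β / h t (n - 1) *
      ∫ y in (0:ℝ)..1, (P t (n - 1)).eval y * (P t n).eval y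
        * genJacobiWeight α β γ t y / (1 - y))
    (hrs : ∀ t < (0:ℝ), ∀ n, 1 ≤ n → rs t n = α / h t (n - 1) *
      ∫ y in (0:ℝ)..1, (P t (n - 1)).eval y * (P t n).eval y
        * genJacobiWeight α β γ t y / y)
    :
    ∀ n : ℕ, 1 ≤ n → ∀ t < (0:ℝ),
      kAux α β γ n (r t n) (rs t n) t ≠ 0 →
      (β + r t n) * r t n ≠ 0 →
      R t n ≠ 0 →
      R t n = (2 * n + 1 + α + β + γ)
          * (lAux α β γ n (r t n) (rs t n) t - t * (1 - t) * deriv (fun s => r s n) t)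
          / (2 * kAux α β γ n (r t n) (rs t n) t) ∧
      (R t n)⁻¹ = (lAux α β γ n (r t n) (rs t n) t + t * (1 - t) * deriv (fun s => r s n) t)
          / (2 * (2 * n + 1 + α + β + γ) * ((β + r t n) * r t n)) ∧
      t ^ 2 * (t - 1) ^ 2 * (deriv (fun s => r s n) t) ^ 2
        = (lAux α β γ n (r t n) (rs t n) t) ^ 2
          - 4 * kAux α β γ n (r t n) (rs t n) t * ((β + r t n) * r t n) := by
  have H : ∀ s < (0 : ℝ), IsMonicOrthogonal (weightFunctional α β γ s) (P s) (h s) := fun s hs =>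
    { monic := fun n => (hmonic s hs n).1
      natDegree_eq := fun n => (hmonic s hs n).2
      ne_zero := fun n => (hpos s hs n).ne'
      apply_mul := fun m n => by
        rw [weightFunctional_apply hα hβ hs, ← horth s hs m n]
        simp only [Polynomial.eval_mul] }
  rintro n hn t ht
  obtain ⟨n, rfl⟩ : ∃ m, n = m + 1 := ⟨n - 1, by omega⟩
  have ht1 : 1 - t ≠ 0 := by linarith
  have hev : ∀ᶠ s in nhds t, s < 0 := eventually_lt_nhds ht
  have Ht := H t ht
  have hKt := paramResolvent_X_sub_C_mul (γ := γ) hα hβ ht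
  have hPearson := weightFunctional_derivative (γ := γ) hα hβ ht
  have hk := hpos t ht n
  have hh := hpos t ht (n + 1)
  have eR : ∀ m, R t m = -β * oneResolvent α β γ t (P t m * P t m) / h t m := fun m => by
    rw [hR t ht, oneResolvent_apply hα hβ ht]
    simp only [Polynomial.eval_mul, sq]
    ring
  have er : ∀ s < (0 : ℝ), r s (n + 1)
      = -β * (oneResolvent α β γ s (P s (n + 1) * P s n) / h s n) := fun s hs => by
    rw [hr s hs _ hn, oneResolvent_apply hα hβ hs, Nat.add_sub_cancel, mul_comm (P s (n + 1))]
    simp only [Polynomial.eval_mul]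
    ring
  have ers : rs t (n + 1) = α * zeroResolvent α β γ t (P t (n + 1) * P t n) / h t n := by
    rw [hrs t ht _ hn, zeroResolvent_apply hα hβ ht, Nat.add_sub_cancel, mul_comm (P t (n + 1))]
    simp only [Polynomial.eval_mul]
    ring
  have hder : deriv (fun s => r s (n + 1)) t = _ :=
    (((IsMonicOrthogonal.hasDerivAt_resolvent_div_norm (by linarith) (hev.mono H) hKt
      oneResolvent_X_sub_C_mul (hasDerivAt_weightFunctional hα hβ ht)
      (hasDerivAt_oneResolvent hα hβ ht) n).const_mul (-β)).congr_of_eventuallyEq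
        (hev.mono er)).deriv
  have det0 := Ht.resolvent_det (a := 0) (K := zeroResolvent α β γ t)
    (fun F => by rw [Polynomial.C_0, sub_zero, zeroResolvent_X_mul]) n
  have det1 := Ht.resolvent_det oneResolvent_X_sub_C_mul n
  have dett := Ht.resolvent_det hKt n
  have self0 := Ht.pearson_self hPearson n
  have self1 := Ht.pearson_self hPearson (n + 1)
  have succ := Ht.pearson_succ hPearson n
  have x0 := Ht.pearson_X_mul_self zeroResolvent_X_mul oneResolvent_X_sub_C_mul hKt hPearson n
  have x1 := Ht.pearson_X_mul_self zeroResolvent_X_mul oneResolvent_X_sub_C_mul hKt hPearson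
    (n + 1)
  have er' := er t ht
  have eR1 := eR (n + 1)
  have hk' := hk.ne'
  have hh' := hh.ne'
  generalize oneResolvent α β γ t (P t (n + 1) * P t n) = A1 at *
  generalize oneResolvent α β γ t (P t (n + 1) * P t (n + 1)) = B1 at *
  generalize oneResolvent α β γ t (P t n * P t n) = C1 at *
  generalize zeroResolvent α β γ t (P t (n + 1) * P t n) = A0 at *
  generalize zeroResolvent α β γ t (P t (n + 1) * P t (n + 1)) = B0 at *
  generalize zeroResolvent α β γ t (P t n * P t n) = C0 at *
  generalize paramResolvent α β γ t (P t (n + 1) * P t n) = At at *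
  generalize paramResolvent α β γ t (P t (n + 1) * P t (n + 1)) = Bt at *
  generalize paramResolvent α β γ t (P t n * P t n) = Ct at *
  have hB0 : R t (n + 1) - γ * Bt / h t (n + 1) = α * B0 / h t (n + 1) := by
    rw [eR1]; field_simp; linarith
  have hC0 : -β * C1 / h t n - γ * Ct / h t n = α * C0 / h t n := by
    field_simp; linarith
  have hAt : r t (n + 1) - rs t (n + 1) - (n + 1 : ℕ) = γ * At / h t n := by
    rw [er', ers]; push_cast; field_simp; linarith
  refine representations_of_determinant_identities (b := h t (n + 1) / h t n)
    (R' := -β * C1 / h t n) (T := γ * Bt / h t (n + 1)) (T' := γ * Ct / h t n) ?_ ?_ ?_ ?_ ?_ ?_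
  · rw [er', eR1]
    field_simp
    linear_combination det1
  · rw [hB0, hC0, ers]
    field_simp
    linear_combination det0
  · rw [hAt]
    field_simp
    linear_combination γ ^ 2 * dett
  · rw [eR1]
    field_simp
    linarith
  · push_cast
    field_simp
    linarith
  · rw [hder, eR1]
    field_simp
    ring
end
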